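/- arXiv:1012.2018 — 5 statements merged into one kernel-verified Lean document; each statement's English description precedes it below -/
import Mathlib

section
/- Let G be a finite group, p an odd prime, and χ an irreducible complex character of G such that χ(x) is a root of unity for every p-singular element x of G. If S is a Sylow p-subgroup of G, then χ(1) ≡ 1 (mod |S|) or χ(1) ≡ −1 (mod |S|). -/
open CategoryTheory Module

/-- A complex endomorphism of finite order is diagonalizable. -/
theorem exists_eigenbasis_of_pow_eq_one {V : Type*} [AddCommGroup V] [Module ℂ V]
    [FiniteDimensional ℂ V] (f : End ℂ V) {n : ℕ} (hn : n ≠ 0) (hf : f ^ n = 1) :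
    ∃ (ι : Type) (_ : Fintype ι) (b : Basis ι ℂ V) (μ : ι → ℂ), ∀ i, f (b i) = μ i • b i := by
  classical
  have hss : f.IsSemisimple := by
    refine Module.End.isSemisimple_of_squarefree_aeval_eq_zero (p := Polynomial.X ^ n - 1)
      (Polynomial.separable_X_pow_sub_C (1 : ℂ) (by exact_mod_cast hn) one_ne_zero).squarefree ?_
    simp [hf]
  have hint := DirectSum.isInternal_submodule_of_iSupIndep_of_iSup_eq_top
    f.eigenspaces_iSupIndep hss.iSup_eigenspace_eq_top
  let b := hint.collectedBasis fun μ ↦ finBasis ℂ (f.eigenspace μ)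
  refine ⟨_, FiniteDimensional.fintypeBasisIndex b, b, Sigma.fst, fun i ↦ ?_⟩
  exact Module.End.mem_eigenspace_iff.1 (hint.collectedBasis_mem _ i)

theorem LinearMap.trace_eq_sum_of_eigenbasis {R V ι : Type*} [CommRing R] [AddCommGroup V]
    [Module R V] [Fintype ι] (b : Basis ι R V) (μ : ι → R) {f : End R V}
    (hf : ∀ i, f (b i) = μ i • b i) : LinearMap.trace R V f = ∑ i, μ i := by
  classical
  rw [LinearMap.trace_eq_matrix_trace R b, Matrix.trace]
  simp [LinearMap.toMatrix_apply, hf]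

theorem Representation.character_inv {G V : Type*} [Group G] [Finite G] [AddCommGroup V]
    [Module ℂ V] [FiniteDimensional ℂ V] (ρ : Representation ℂ G V) (g : G) :
    ρ.character g⁻¹ = starRingEnd ℂ (ρ.character g) := by
  have hn : orderOf g ≠ 0 := (orderOf_pos g).ne'
  obtain ⟨ι, _, b, μ, hb⟩ := exists_eigenbasis_of_pow_eq_one (ρ g) hn
    (by rw [← map_pow, pow_orderOf_eq_one, map_one])
  have hpow (k : ℕ) (i : ι) : (ρ g ^ k) (b i) = μ i ^ k • b i := by
    induction k with
    | zero => simp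
    | succ k ih => rw [pow_succ, Module.End.mul_apply, hb, map_smul, ih, smul_smul, pow_succ']
  have hμ (i : ι) : μ i ^ orderOf g = 1 := by
    have h := hpow (orderOf g) i
    rw [← map_pow, pow_orderOf_eq_one, map_one, Module.End.one_apply] at h
    refine smul_left_injective ℂ (b.ne_zero i) ?_
    simp [← h]
  have hinv (i : ι) : ρ g⁻¹ (b i) = starRingEnd ℂ (μ i) • b i := by
    have hnorm : ‖μ i‖ = 1 := Complex.norm_eq_one_of_pow_eq_one (hμ i) hn
    have h0 : μ i ≠ 0 := by rintro h; simp [h] at hnorm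
    rw [← Complex.inv_eq_conj hnorm, eq_inv_smul_iff₀ h0, ← map_smul, ← hb,
      ← Module.End.mul_apply, ← map_mul, inv_mul_cancel, map_one, Module.End.one_apply]
  rw [Representation.character, Representation.character,
    LinearMap.trace_eq_sum_of_eigenbasis b _ hb, LinearMap.trace_eq_sum_of_eigenbasis b _ hinv,
    map_sum]

/-- If a character has absolute value one off the identity, then the group order divides
`χ(1) ^ 2 - 1`. -/
theorem Representation.card_dvd_finrank_sq_sub_one {G V : Type*} [Group G] [Finite G]
    [AddCommGroup V] [Module ℂ V] [FiniteDimensional ℂ V] (ρ : Representation ℂ G V)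
    (h : ∀ g : G, g ≠ 1 → ‖ρ.character g‖ = 1) :
    (Nat.card G : ℤ) ∣ (finrank ℂ V : ℤ) ^ 2 - 1 := by
  classical
  have := Fintype.ofFinite G
  have h0 : (Nat.card G : ℂ) ≠ 0 := by exact_mod_cast Nat.card_pos.ne'
  have := invertibleOfNonzero h0
  have key := ρ.card_inv_mul_sum_char_mul_char_eq_finrank ρ
  have hsum : ∑ g : G, ρ.character g * ρ.character g⁻¹ =
      (finrank ℂ V : ℂ) ^ 2 - 1 + Nat.card G := by
    have hterm (g : G) : ρ.character g * ρ.character g⁻¹ =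
        1 + if g = 1 then (finrank ℂ V : ℂ) ^ 2 - 1 else 0 := by
      split_ifs with hg
      · simp [hg, sq]
      · rw [ρ.character_inv, Complex.mul_conj, Complex.normSq_eq_norm_sq, h g hg]
        simp
    simp [hterm, Finset.sum_add_distrib, add_comm]
  rw [hsum, inv_mul_eq_iff_eq_mul₀ h0] at key
  have key' : (finrank ℂ V : ℤ) ^ 2 - 1 + Nat.card G =
      Nat.card G * finrank ℂ (IntertwiningMap ρ ρ) := by exact_mod_cast key
  exact (dvd_add_left dvd_rfl).1 ⟨_, key'⟩

theorem Int.modEq_one_or_neg_one_of_prime_pow_dvd {p k : ℕ} (hp : p.Prime) (hodd : Odd p) {d : ℤ}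
    (h : ((p ^ k : ℕ) : ℤ) ∣ d ^ 2 - 1) :
    d ≡ 1 [ZMOD (p ^ k : ℕ)] ∨ d ≡ -1 [ZMOD (p ^ k : ℕ)] := by
  have hp' : Prime (p : ℤ) := Nat.prime_iff_prime_int.1 hp
  have hfac : (p : ℤ) ^ k ∣ (d - 1) * (d + 1) := by
    rw [show (d - 1) * (d + 1) = d ^ 2 - 1 by ring]
    exact_mod_cast h
  rw [Int.modEq_comm, Int.modEq_iff_dvd, Int.modEq_comm, Int.modEq_iff_dvd, sub_neg_eq_add]
  push_cast
  by_cases hd : (p : ℤ) ∣ d + 1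
  · refine .inr (hp'.pow_dvd_of_dvd_mul_left k (fun hd' ↦ ?_) hfac)
    have h2 : (p : ℤ) ∣ (2 : ℕ) := by simpa [show d + 1 - (d - 1) = 2 by ring] using dvd_sub hd hd'
    have := (Nat.prime_dvd_prime_iff_eq hp Nat.prime_two).1 (Int.natCast_dvd_natCast.1 h2)
    exact absurd hodd (by simp [this])
  · exact .inl (hp'.pow_dvd_of_dvd_mul_right k hd hfac)

/-- **Lemma 2.3(a)** (Navarro–Robinson), odd-prime part. If `p` is odd and the irreducible
complex character of `V` takes root of unity values on all `p`-singular elements of `G`,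
then `χ(1) ≡ 1 (mod |S|)` or `χ(1) ≡ -1 (mod |S|)` for `S` a Sylow `p`-subgroup. -/
theorem stmt_4 {G : Type} [Group G] [Fintype G] (p : ℕ) (hp : p.Prime) (hodd : Odd p)
    (V : FDRep ℂ G) (hV : Simple V)
    (hroot : ∀ x : G, p ∣ orderOf x → ∃ n : ℕ, 0 < n ∧ V.character x ^ n = 1)
    (S : Sylow p G) :
    ((finrank ℂ V : ℤ) ≡ 1 [ZMOD (Nat.card (S : Subgroup G))]) ∨
      ((finrank ℂ V : ℤ) ≡ -1 [ZMOD (Nat.card (S : Subgroup G))]) := by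
  have := Fact.mk hp
  obtain ⟨k, hk⟩ := IsPGroup.iff_card.1 S.isPGroup'
  have hdvd := Representation.card_dvd_finrank_sq_sub_one
    (V.ρ.comp (S : Subgroup G).subtype) fun g hg ↦ by
      obtain ⟨j, hj⟩ := IsPGroup.iff_orderOf.1 S.isPGroup' g
      have hj0 : j ≠ 0 := by
        rintro rfl
        exact hg (orderOf_eq_one_iff.1 (by simpa using hj))
      obtain ⟨n, hn, hpow⟩ := hroot g (by
        rw [Subgroup.orderOf_coe, hj]
        exact dvd_pow_self p hj0)
      exact Complex.norm_eq_one_of_pow_eq_one hpow hn.ne'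
  rw [hk] at hdvd ⊢
  exact Int.modEq_one_or_neg_one_of_prime_pow_dvd hp hodd hdvd
end

section
/- Let G be a finite group, p a prime, and χ an irreducible complex character of G such that χ(x) is a root of unity for every p-singular element x of G. If M is a normal subgroup of G whose order is divisible by p, then the restriction of χ to M is a sum of pairwise distinct irreducible characters of M (i.e., every irreducible constituent of χ restricted to M occurs with multiplicity 1). -/
open CategoryTheory Module

theorem LinearMap.isIntegral_trace_of_pow_eq_one {K V : Type*} [Field K] [IsAlgClosed K]
    [AddCommGroup V] [Module K V] [FiniteDimensional K V] (f : End K V) {n : ℕ} (hn : 0 < n)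
    (hf : f ^ n = 1) : IsIntegral ℤ (LinearMap.trace K V f) := by
  rw [Module.End.trace_eq_sum_roots_charpoly_of_splits (IsAlgClosed.splits _)]
  refine IsIntegral.multiset_sum fun μ hμ ↦ IsIntegral.of_pow hn ?_
  have hμ' : f.HasEigenvalue μ :=
    (Module.End.hasEigenvalue_iff_isRoot_charpoly f μ).2 (Polynomial.isRoot_of_mem_roots hμ)
  obtain ⟨v, hv⟩ := hμ'.exists_hasEigenvector
  have h := hv.pow_apply n
  rw [hf, Module.End.one_apply] at h
  have : μ ^ n = 1 := by
    have h2 : (μ ^ n - 1) • v = 0 := by rw [sub_smul, one_smul, ← h, sub_self]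
    exact sub_eq_zero.1 ((smul_eq_zero.1 h2).resolve_right hv.2)
  rw [this]
  exact isIntegral_one

theorem LinearMap.trace_eq_add_of_isCompl {K V : Type*} [Field K] [AddCommGroup V] [Module K V]
    [FiniteDimensional K V] {A B : Submodule K V} (h : IsCompl A B) (f : End K V)
    (hA : ∀ v ∈ A, f v ∈ A) (hB : ∀ v ∈ B, f v ∈ B) :
    LinearMap.trace K V f =
      LinearMap.trace K A (f.restrict hA) + LinearMap.trace K B (f.restrict hB) := by
  rw [← LinearMap.trace_prodMap', ← LinearMap.trace_conj' _ (A.prodEquivOfIsCompl B h)]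
  congr 1
  ext v
  obtain ⟨w, rfl⟩ := (A.prodEquivOfIsCompl B h).surjective v
  simp [LinearEquiv.conj_apply, Submodule.coe_prodEquivOfIsCompl]

theorem FDRep.isIntegral_character {H : Type} [Group H] [Finite H] (V : FDRep ℂ H) (x : H) :
    IsIntegral ℤ (V.character x) :=
  LinearMap.isIntegral_trace_of_pow_eq_one _ (orderOf_pos x) <| by
    rw [← map_pow, pow_orderOf_eq_one, map_one]

theorem FDRep.simple_of_isIrreducible {H : Type} [Group H] [Finite H] {U : Type}
    [AddCommGroup U] [Module ℂ U] [FiniteDimensional ℂ U] (ρ : Representation ℂ H U)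
    [ρ.IsIrreducible] : Simple (FDRep.of ρ) := by
  have := Fintype.ofFinite H
  have := invertibleOfNonzero (NeZero.ne (Nat.card H : ℂ))
  rw [FDRep.simple_iff_char_is_norm_one]
  have h := Representation.char_orthonormal ρ ρ
  rw [if_pos ⟨Representation.Equiv.refl _⟩, inv_mul_eq_one₀ (NeZero.ne _)] at h
  exact h.symm

/-- Every finite-dimensional complex representation of a finite group is a direct sum of simple
subrepresentations; here this is recorded through equivariant embeddings and characters. -/
theorem Representation.exists_simple_character_eq_sum {H : Type} [Group H] [Finite H] {U : Type}
    [AddCommGroup U] [Module ℂ U] [FiniteDimensional ℂ U] (ρ : Representation ℂ H U) :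
    ∃ (ι : Type) (_ : Fintype ι) (S : ι → FDRep ℂ H),
      (∀ i, Simple (S i)) ∧ (∀ x, ρ.character x = ∑ i, (S i).character x) ∧
      ∀ i, ∃ f : S i →ₗ[ℂ] U, Function.Injective f ∧ ∀ x s, f ((S i).ρ x s) = ρ x (f s) := by
  induction hn : finrank ℂ U using Nat.strong_induction_on generalizing U with
  | _ n ih =>
  subst hn
  rcases subsingleton_or_nontrivial U with hU | hU
  · refine ⟨Empty, inferInstance, Empty.elim, fun i ↦ i.elim, fun x ↦ ?_, fun i ↦ i.elim⟩
    have : ρ x = 0 := Subsingleton.elim _ _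
    simp [Representation.character, this]
  by_cases hirr : ρ.IsIrreducible
  · exact ⟨Unit, inferInstance, fun _ ↦ FDRep.of ρ, fun _ ↦ FDRep.simple_of_isIrreducible ρ,
      fun x ↦ by simp [Representation.character, FDRep.character], fun _ ↦
      ⟨LinearMap.id, Function.injective_id, fun _ _ ↦ rfl⟩⟩
  have hnt : Nontrivial (Subrepresentation ρ) := by
    refine ⟨⊥, ⊤, fun h ↦ ?_⟩
    have : (⊥ : Submodule ℂ U) = ⊤ := congrArg Subrepresentation.toSubmodule h
    exact bot_ne_top this
  obtain ⟨A, hA⟩ : ∃ A : Subrepresentation ρ, A ≠ ⊥ ∧ A ≠ ⊤ := by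
    by_contra! h
    exact hirr ⟨fun A ↦ or_iff_not_imp_left.2 (h A)⟩
  obtain ⟨B, hAB⟩ := exists_isCompl A
  have hc : IsCompl A.toSubmodule B.toSubmodule := by
    refine IsCompl.of_eq ?_ ?_
    · exact congrArg Subrepresentation.toSubmodule hAB.inf_eq_bot
    · exact congrArg Subrepresentation.toSubmodule hAB.sup_eq_top
  have hA' : A.toSubmodule ≠ ⊤ := fun h ↦ hA.2 (Subrepresentation.toSubmodule_injective h)
  have hB' : B.toSubmodule ≠ ⊤ := fun h ↦ hA.1 <| Subrepresentation.toSubmodule_injective <| by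
    have := hc.inf_eq_bot
    rwa [h, inf_top_eq] at this
  obtain ⟨ι, hι, S, hS, hχ, hf⟩ := ih _ (Submodule.finrank_lt hA') A.toRepresentation rfl
  obtain ⟨κ, hκ, T, hT, hψ, hg⟩ := ih _ (Submodule.finrank_lt hB') B.toRepresentation rfl
  refine ⟨ι ⊕ κ, inferInstance, Sum.elim S T, ?_, fun x ↦ ?_, ?_⟩
  · rintro (i | i)
    exacts [hS i, hT i]
  · rw [Fintype.sum_sum_type]
    refine (LinearMap.trace_eq_add_of_isCompl hc (ρ x) (A.apply_mem_toSubmodule x)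
      (B.apply_mem_toSubmodule x)).trans ?_
    exact congrArg₂ (· + ·) (hχ x) (hψ x)
  · rintro (i | i)
    · obtain ⟨f, hf, hf'⟩ := hf i
      exact ⟨A.toSubmodule.subtype ∘ₗ f, Subtype.val_injective.comp hf,
        fun x s ↦ congrArg Subtype.val (hf' x s)⟩
    · obtain ⟨f, hf, hf'⟩ := hg i
      exact ⟨B.toSubmodule.subtype ∘ₗ f, Subtype.val_injective.comp hf,
        fun x s ↦ congrArg Subtype.val (hf' x s)⟩

/-- Schur's lemma for simple complex representations, in terms of linear maps. -/
theorem FDRep.exists_smul_one_of_commute {G : Type} [Group G] [Finite G] (V : FDRep ℂ G)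
    [Simple V] (T : End ℂ V) (hT : ∀ g, Commute (V.ρ g) T) : ∃ c : ℂ, T = c • 1 := by
  have := Fintype.ofFinite G
  have := invertibleOfNonzero (NeZero.ne (Nat.card G : ℂ))
  have h1 := V.scalar_product_char_eq_finrank_equivariant V
  rw [finrank_endomorphism_simple_eq_one] at h1
  have h2 := Representation.card_inv_mul_sum_char_mul_char_eq_finrank V.ρ V.ρ
  have h3 : finrank ℂ (Representation.IntertwiningMap V.ρ V.ρ) = 1 := by
    exact_mod_cast h2.symm.trans h1
  have hne : Representation.IntertwiningMap.id V.ρ ≠ 0 := by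
    intro h0
    have : Nontrivial (Representation.IntertwiningMap V.ρ V.ρ) :=
      Module.nontrivial_of_finrank_pos (R := ℂ) (by omega)
    obtain ⟨f, hf⟩ := exists_ne (0 : Representation.IntertwiningMap V.ρ V.ρ)
    apply hf
    ext v
    have : v = 0 := congrArg (fun f ↦ f.toLinearMap v) h0
    simp [this]
  obtain ⟨c, hc⟩ := (finrank_eq_one_iff_of_nonzero' _ hne).1 h3 ⟨T, fun g ↦ (hT g).symm.eq⟩
  exact ⟨c, (congrArg (fun f ↦ f.toLinearMap) hc).symm⟩

theorem FDRep.sum_character_conjNormal_smul_ρ_commute {G : Type} [Group G] [Fintype G]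
    (V : FDRep ℂ G) (M : Subgroup G) [M.Normal] [Fintype M] (φ : M → ℂ) (h : G) :
    Commute (V.ρ h) (∑ m : M, (∑ g : G, φ (MulAut.conjNormal g m)) • V.ρ (m : G)) := by
  rw [Commute, SemiconjBy, Finset.mul_sum, Finset.sum_mul]
  refine Fintype.sum_equiv (MulAut.conjNormal h).toEquiv _ _ fun m ↦ ?_
  have h1 : ∑ g : G, φ (MulAut.conjNormal g (MulAut.conjNormal h m)) =
      ∑ g : G, φ (MulAut.conjNormal g m) :=
    Fintype.sum_equiv (Equiv.mulRight h) _ _ fun g ↦ by simp [map_mul]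
  rw [mul_smul_comm, smul_mul_assoc, ← map_mul]
  simp only [MulEquiv.toEquiv_eq_coe, MulEquiv.coe_toEquiv, h1, MulAut.conjNormal_apply,
    ← map_mul, inv_mul_cancel_right]

/-- The multiplicity of an irreducible character of a normal subgroup in the restriction of a
character does not change under conjugation. -/
theorem FDRep.sum_character_mul_conjNormal {G : Type} [Group G] (V : FDRep ℂ G)
    (M : Subgroup G) [M.Normal] [Fintype M] (φ : M → ℂ) (g : G) :
    ∑ m : M, V.character m * φ (MulAut.conjNormal g m) = ∑ m : M, V.character m * φ m :=
  Fintype.sum_equiv (MulAut.conjNormal g).toEquiv _ _ fun m ↦ by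
    simp [MulAut.conjNormal_apply]

theorem FDRep.finrank_ne_zero {H : Type} [Group H] [Finite H] (S : FDRep ℂ H) [Simple S] :
    finrank ℂ S ≠ 0 := by
  have := Fintype.ofFinite H
  intro h0
  have h1 := (FDRep.simple_iff_char_is_norm_one S).1 inferInstance
  have h2 : ∀ x, S.character x = 0 := fun x ↦ by
    have := Module.finrank_zero_iff.1 h0
    rw [FDRep.character, Subsingleton.elim (S.ρ x) 0, map_zero]
  simp only [h2, mul_zero, Finset.sum_const_zero] at h1
  exact NeZero.ne _ h1.symm

/-- Distinct irreducible characters are orthogonal. -/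
theorem FDRep.character_eq_of_sum_ne_zero {H : Type} [Group H] [Fintype H] (V W : FDRep ℂ H)
    [Simple V] [Simple W] (h : ∑ x : H, V.character x * W.character x⁻¹ ≠ 0) :
    V.character = W.character := by
  classical
  have := invertibleOfNonzero (NeZero.ne (Nat.card H : ℂ))
  have h1 := FDRep.char_orthonormal V W
  split_ifs at h1 with h2
  · exact FDRep.char_iso h2.some
  · exact absurd h1 (mul_ne_zero (inv_ne_zero (NeZero.ne _)) h)

theorem FDRep.simple_of_character_eq_comp {H : Type} [Group H] [Finite H] (V W : FDRep ℂ H)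
    [Simple W] (σ : MulAut H) (h : ∀ x, V.character x = W.character (σ x)) : Simple V := by
  have := Fintype.ofFinite H
  rw [FDRep.simple_iff_char_is_norm_one, ← (FDRep.simple_iff_char_is_norm_one W).1 inferInstance]
  exact Fintype.sum_equiv σ.toEquiv _ _ fun x ↦ by simp [h]

/-- **Clifford's theorem**: all irreducible constituents of the restriction of an irreducible
representation to a normal subgroup are conjugate. -/
theorem FDRep.exists_character_eq_conjNormal {G : Type} [Group G] [Finite G] (V : FDRep ℂ G)
    [Simple V] (M : Subgroup G) [M.Normal] [Fintype M] (W S : FDRep ℂ M) [Simple W] [Simple S]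
    (f : S →ₗ[ℂ] V) (hf : Function.Injective f) (hfS : ∀ x s, f (S.ρ x s) = V.ρ (x : G) (f s))
    (hW : ∑ m : M, V.character m * W.character m⁻¹ ≠ 0) :
    ∃ g : G, ∀ m, S.character m = W.character (MulAut.conjNormal g m) := by
  have := Fintype.ofFinite G
  set F : M → ℂ := fun m ↦ ∑ g : G, W.character (MulAut.conjNormal g m)⁻¹ with hF
  obtain ⟨c, hc⟩ := V.exists_smul_one_of_commute (∑ m : M, F m • V.ρ (m : G))
    (V.sum_character_conjNormal_smul_ρ_commute M fun m ↦ W.character m⁻¹)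
  have hS : ∑ m : M, F m • S.ρ m = c • 1 := by
    ext s
    apply hf
    have := LinearMap.congr_fun hc (f s)
    simpa [LinearMap.sum_apply, hfS] using this
  have hc0 : c ≠ 0 := by
    rintro rfl
    have h1 := congrArg (LinearMap.trace ℂ V) hc
    simp only [map_sum, map_smul, zero_smul, map_zero, hF, smul_eq_mul, Finset.sum_mul] at h1
    rw [Finset.sum_comm] at h1
    have h2 (g : G) := V.sum_character_mul_conjNormal M (fun m ↦ W.character m⁻¹) g
    simp only [FDRep.character] at h1 h2 hW
    simp only [mul_comm (LinearMap.trace ℂ W _), h2, Finset.sum_const, Finset.card_univ,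
      smul_eq_zero, Fintype.card_ne_zero, false_or] at h1
    exact hW h1
  have h1 := congrArg (LinearMap.trace ℂ S) hS
  simp only [map_sum, map_smul, hF, smul_eq_mul, Finset.sum_mul, LinearMap.trace_one] at h1
  rw [Finset.sum_comm] at h1
  have h2 : c * (finrank ℂ S : ℂ) ≠ 0 := mul_ne_zero hc0 (Nat.cast_ne_zero.2 S.finrank_ne_zero)
  rw [← h1] at h2
  obtain ⟨g, -, hg⟩ := Finset.exists_ne_zero_of_sum_ne_zero h2
  let Wg : FDRep ℂ M := FDRep.of (W.ρ.comp (MulAut.conjNormal g : MulAut M).toMonoidHom)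
  have hWg (m : M) : Wg.character m = W.character (MulAut.conjNormal g m) := rfl
  have : Simple Wg := FDRep.simple_of_character_eq_comp Wg W _ hWg
  refine ⟨g, fun m ↦ ?_⟩
  rw [← hWg, S.character_eq_of_sum_ne_zero Wg]
  convert hg using 2 with m
  rw [hWg, map_inv, mul_comm]
  rfl

theorem FDRep.exists_multiplicity_mul_isIntegral_eq_character {G : Type} [Group G] [Finite G]
    (V : FDRep ℂ G) [Simple V] (M : Subgroup G) [M.Normal] [Fintype M] (W : FDRep ℂ M) [Simple W]
    (hW : ∑ m : M, V.character m * W.character m⁻¹ ≠ 0) :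
    ∃ e : ℕ, (Nat.card M : ℂ)⁻¹ * ∑ m : M, V.character m * W.character m⁻¹ = e ∧
      ∀ x : M, ∃ α : ℂ, IsIntegral ℤ α ∧ V.character x = e * α := by
  classical
  have := invertibleOfNonzero (NeZero.ne (Nat.card M : ℂ))
  obtain ⟨ι, _, S, hS, hχ, hf⟩ :=
    Representation.exists_simple_character_eq_sum (V.ρ.comp M.subtype)
  replace hχ (x : M) : V.character x = ∑ i, (S i).character x := hχ x
  refine ⟨_, W.scalar_product_char_eq_finrank_equivariant (FDRep.of (V.ρ.comp M.subtype)),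
    fun x ↦ ?_⟩
  have he := W.scalar_product_char_eq_finrank_equivariant (FDRep.of (V.ρ.comp M.subtype))
  generalize finrank ℂ (W ⟶ FDRep.of (V.ρ.comp M.subtype)) = e at he ⊢
  replace he : (Nat.card M : ℂ)⁻¹ * ∑ m : M, V.character m * W.character m⁻¹ = e := he
  have hcard (j : ι) : (Finset.univ.filter fun i ↦ (S i).character = (S j).character).card = e := by
    obtain ⟨f, hf, hfS⟩ := hf j
    obtain ⟨g, hg⟩ := V.exists_character_eq_conjNormal M W (S j) f hf hfS hW
    have h1 := V.sum_character_mul_conjNormal M (fun m ↦ W.character m⁻¹) g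
    simp only [← map_inv, ← hg] at h1
    rw [← h1] at he
    simp only [hχ, Finset.sum_mul] at he
    rw [Finset.sum_comm, Finset.mul_sum] at he
    have h2 (i : ι) : (Nat.card M : ℂ)⁻¹ * ∑ m, (S i).character m * (S j).character m⁻¹ =
        if (S i).character = (S j).character then 1 else 0 := by
      have := hS i
      have := hS j
      split_ifs with h
      · rw [h, FDRep.char_orthonormal, if_pos ⟨Iso.refl _⟩]
      · by_contra h0
        exact h ((S i).character_eq_of_sum_ne_zero (S j) (right_ne_zero_of_mul h0))
    simp only [h2, Finset.sum_boole] at he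
    exact_mod_cast he
  refine ⟨∑ ψ ∈ Finset.univ.image fun i ↦ (S i).character, ψ x, ?_, ?_⟩
  · refine IsIntegral.sum _ fun ψ hψ ↦ ?_
    obtain ⟨i, -, rfl⟩ := Finset.mem_image.1 hψ
    exact (S i).isIntegral_character x
  · rw [hχ, Finset.sum_comp (fun ψ : M → ℂ ↦ ψ x) fun i ↦ (S i).character, Finset.mul_sum]
    refine Finset.sum_congr rfl fun ψ hψ ↦ ?_
    obtain ⟨j, -, rfl⟩ := Finset.mem_image.1 hψ
    rw [hcard, nsmul_eq_mul]

theorem Nat.eq_one_of_isIntegral_of_mul_pow_eq_one {e n : ℕ} (hn : 0 < n) {α : ℂ}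
    (hα : IsIntegral ℤ α) (h : ((e : ℂ) * α) ^ n = 1) : e = 1 := by
  have he : (e : ℂ) ^ n ≠ 0 := fun h0 ↦ by simp [mul_pow, h0] at h
  have h1 : α ^ n = algebraMap ℚ ℂ (((e ^ n : ℕ) : ℚ)⁻¹) := by
    rw [mul_pow] at h
    rw [eq_inv_of_mul_eq_one_right h]
    simp
  have h2 : IsIntegral ℤ (((e ^ n : ℕ) : ℚ)⁻¹) := by
    have := hα.pow n
    rwa [h1, isIntegral_algebraMap_iff (algebraMap ℚ ℂ).injective] at this
  obtain ⟨k, hk⟩ := IsIntegrallyClosed.isIntegral_iff.1 h2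
  have h3 : ((e ^ n : ℕ) : ℤ) * k = 1 := by
    have h0 : ((e ^ n : ℕ) : ℚ) ≠ 0 := by exact_mod_cast he
    have : ((e ^ n : ℕ) : ℚ) * (k : ℚ) = 1 := by
      rw [show (k : ℚ) = _ from hk, mul_inv_cancel₀ h0]
    exact_mod_cast this
  have h4 : e ^ n = 1 := by
    have := Int.isUnit_iff.1 (IsUnit.of_mul_eq_one k h3)
    omega
  exact (Nat.pow_eq_one.1 h4).resolve_right hn.ne'

open scoped Classical in
/-- **Lemma 2.3(b)** (Navarro–Robinson). If the irreducible complex character `χ` of `V`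
takes root of unity values on all `p`-singular elements of the finite group `G`, and `M` is
a normal subgroup of `G` of order divisible by `p`, then every irreducible constituent of
the restriction `χ_M` occurs with multiplicity `0` or `1`: for every irreducible character
of `M` (afforded by a simple `W : FDRep ℂ M`), the multiplicity
`[χ_M, W] = |M|⁻¹ ∑_{m ∈ M} χ(m)·ψ_W(m⁻¹)` equals `0` or `1`. -/
theorem stmt_6 {G : Type} [Group G] [Fintype G] (p : ℕ) (hp : p.Prime)
    (V : FDRep ℂ G) (hV : Simple V)
    (hroot : ∀ x : G, p ∣ orderOf x → ∃ n : ℕ, 0 < n ∧ V.character x ^ n = 1)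
    (M : Subgroup G) (hM : M.Normal) (hpM : p ∣ Nat.card M)
    (W : FDRep ℂ M) (hW : Simple W) :
    (Nat.card M : ℂ)⁻¹ * ∑ m : M, V.character ↑m * W.character m⁻¹ = 0 ∨
      (Nat.card M : ℂ)⁻¹ * ∑ m : M, V.character ↑m * W.character m⁻¹ = 1 := by
  rw [or_iff_not_imp_left]
  intro h0
  obtain ⟨e, he, hα⟩ :=
    V.exists_multiplicity_mul_isIntegral_eq_character M W (right_ne_zero_of_mul h0)
  have := Fact.mk hp
  obtain ⟨x, hx⟩ := exists_prime_orderOf_dvd_card' p hpM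
  obtain ⟨n, hn, hxn⟩ := hroot x (by rw [Subgroup.orderOf_coe, hx])
  obtain ⟨α, hα, hxα⟩ := hα x
  rw [hxα] at hxn
  rw [he, Nat.eq_one_of_isIntegral_of_mul_pow_eq_one hn hα hxn, Nat.cast_one]
end

section
/- Let G be a finite group, p a prime, and χ an irreducible complex character of G such that χ(x) is a root of unity for every p-singular element x of G. Let M be a subgroup of G having a normal p-complement N and a non-trivial Sylow p-subgroup P. Then [χ_M, χ_M] = 1 + ([χ_N, χ_N] − 1)/|P|, where χ_M and χ_N denote the restrictions of χ to M and N, and [·,·] is the usual inner product of class functions. -/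
open CategoryTheory Module

/-- If a normal subgroup has `p`-power index, every element outside it is `p`-singular. -/
lemma Subgroup.dvd_orderOf_of_index_eq_pow {M : Type*} [Group M] {p : ℕ} (hp : p.Prime)
    (N : Subgroup M) [N.Normal] {k : ℕ} (hk : N.index = p ^ k) {m : M} (hm : m ∉ N) :
    p ∣ orderOf m := by
  have hpow : orderOf (m : M ⧸ N) ∣ p ^ k := by
    rw [← hk, Subgroup.index]
    exact _root_.orderOf_dvd_natCard (m : M ⧸ N)
  obtain ⟨j, -, hj⟩ := (Nat.dvd_prime_pow hp).1 hpow
  have hj0 : j ≠ 0 := by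
    rintro rfl
    rw [pow_zero, orderOf_eq_one_iff, QuotientGroup.eq_one_iff m] at hj
    exact hm hj
  exact ((dvd_pow_self p hj0).trans hj.symm.dvd).trans (orderOf_map_dvd (QuotientGroup.mk' N) m)

lemma Complex.mul_conj_eq_one_of_pow_eq_one {z : ℂ} {n : ℕ} (hn : n ≠ 0) (hz : z ^ n = 1) :
    z * (starRingEnd ℂ) z = 1 := by
  rw [Complex.mul_conj, Complex.normSq_eq_norm_sq, Complex.norm_eq_one_of_pow_eq_one hz hn]
  norm_num

open scoped Classical in
/-- The average over a finite group of a function equal to `1` outside a subgroup. -/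
lemma Subgroup.average_eq_of_eq_one_off {M : Type*} [Group M] [Fintype M] (N : Subgroup M)
    (f : M → ℂ) (hf : ∀ m ∉ N, f m = 1) :
    (Nat.card M : ℂ)⁻¹ * ∑ m, f m =
      1 + ((Nat.card N : ℂ)⁻¹ * ∑ n : N, f n - 1) / (N.index : ℂ) := by
  have hsum : ∑ m, (f m - 1) = ∑ n : N, (f n - 1) := by
    rw [← Finset.sum_subtype {m : M | m ∈ N} (by simp) (fun m => f m - 1)]
    refine (Finset.sum_subset (Finset.subset_univ _) fun m _ hm => ?_).symm
    rw [hf m (by simpa using hm), sub_self]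
  simp only [Finset.sum_sub_distrib, Finset.sum_const, Finset.card_univ, nsmul_eq_mul, mul_one,
    ← Nat.card_eq_fintype_card] at hsum
  have hN0 : (Nat.card N : ℂ) ≠ 0 := by exact_mod_cast Nat.card_pos.ne'
  have hI0 : (N.index : ℂ) ≠ 0 := by exact_mod_cast N.index_ne_zero_of_finite
  have hcard : (Nat.card M : ℂ) = Nat.card N * N.index := by exact_mod_cast N.card_mul_index.symm
  rw [hcard] at hsum ⊢
  rw [sub_eq_iff_eq_add.1 hsum]
  field_simp
  ring

open scoped Classical in
/-- **Lemma 2.3(c)** (Navarro–Robinson). Let `χ` be an irreducible complex character of a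
finite group `G` taking root of unity values on all `p`-singular elements. If `M ≤ G` has a
normal `p`-complement `N` and a non-trivial Sylow `p`-subgroup `P`, then
`[χ_M, χ_M] = 1 + ([χ_N, χ_N] - 1)/|P|`. -/
theorem stmt_8 {G : Type} [Group G] [Fintype G] (p : ℕ) (hp : p.Prime)
    (V : FDRep ℂ G) (hV : Simple V)
    (hroot : ∀ x : G, p ∣ orderOf x → ∃ n : ℕ, 0 < n ∧ V.character x ^ n = 1)
    (M : Subgroup G) (N : Subgroup M) (P : Sylow p M)
    (hNnormal : N.Normal) (hN : ¬ p ∣ Nat.card N)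
    (hindex : N.index = Nat.card (P : Subgroup M))
    (hP : (P : Subgroup M) ≠ ⊥) :
    (Nat.card M : ℂ)⁻¹ *
        ∑ m : M, V.character ↑m * (starRingEnd ℂ) (V.character ↑m) =
      1 + ((Nat.card N : ℂ)⁻¹ *
          ∑ n : N, V.character ↑↑n * (starRingEnd ℂ) (V.character ↑↑n) - 1) /
        (Nat.card (P : Subgroup M) : ℂ) := by
  have : Fact p.Prime := ⟨hp⟩
  obtain ⟨k, hk⟩ := IsPGroup.iff_card.1 P.isPGroup'
  rw [← hindex]
  refine N.average_eq_of_eq_one_off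
    (fun m : M => V.character ↑m * (starRingEnd ℂ) (V.character ↑m)) fun m hm => ?_
  have hdvd := N.dvd_orderOf_of_index_eq_pow hp (hindex.trans hk) hm
  rw [← Subgroup.orderOf_coe] at hdvd
  obtain ⟨n, hn, hχ⟩ := hroot m hdvd
  exact Complex.mul_conj_eq_one_of_pow_eq_one hn.ne' hχ
end

section
/- Let G be a finite group, p a prime, and χ a faithful, non-linear irreducible complex character of G that takes root of unity values on all p-singular elements of G. Assume P = O_p(G) > 1. Then one of the following holds: (1) P is an elementary abelian Sylow p-subgroup of G, C_G(P) = P × Z(G), the conjugation action of G/C_G(P) on the set Irr(P) ∖ {1_P} of non-trivial irreducible characters of P is transitive, and χ(1) = |P| − 1; or (2) p = 2 and G = S_4 × Z(G) with |Z(G)| odd. -/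
open CategoryTheory Module

section WeightProj

variable {A W : Type*} [CommGroup A] [Fintype A] [AddCommGroup W] [Module ℂ W]

/-- The projection of a representation of a finite abelian group onto the weight space of a
linear character. -/
noncomputable def weightProj (σ : A →* Module.End ℂ W) (χ : A →* ℂˣ) : Module.End ℂ W :=
  (Fintype.card A : ℂ)⁻¹ • ∑ a : A, ((χ a⁻¹ : ℂˣ) : ℂ) • σ a

theorem card_ne_zero_complex : (Fintype.card A : ℂ) ≠ 0 :=
  Nat.cast_ne_zero.mpr Fintype.card_ne_zero

theorem mul_weightProj (σ : A →* Module.End ℂ W) (χ : A →* ℂˣ) (b : A) :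
    σ b * weightProj σ χ = ((χ b : ℂˣ) : ℂ) • weightProj σ χ := by
  unfold weightProj
  rw [mul_smul_comm, smul_comm]
  congr 1
  rw [Finset.mul_sum, Finset.smul_sum]
  refine Fintype.sum_equiv (Equiv.mulLeft b) _ _ fun a => ?_
  rw [mul_smul_comm, ← map_mul, smul_smul, Equiv.coe_mulLeft, ← Units.val_mul, ← map_mul]
  rw [mul_inv, mul_inv_cancel_left]

theorem sum_char_eq_zero {χ : A →* ℂˣ} (h : χ ≠ 1) : ∑ a, ((χ a : ℂˣ) : ℂ) = 0 := by
  refine sum_hom_units_eq_zero ((Units.coeHom ℂ).comp χ) fun h' => h ?_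
  ext a
  simpa using DFunLike.congr_fun h' a

theorem weightProj_mul_self (σ : A →* Module.End ℂ W) (χ : A →* ℂˣ) :
    weightProj σ χ * weightProj σ χ = weightProj σ χ := by
  conv_lhs => enter [1]; unfold weightProj
  rw [smul_mul_assoc, Finset.sum_mul]
  have : ∀ a : A, (((χ a⁻¹ : ℂˣ) : ℂ) • σ a) * weightProj σ χ = weightProj σ χ := fun a => by
    rw [smul_mul_assoc, mul_weightProj, smul_smul, ← Units.val_mul, ← map_mul]
    simp
  rw [Finset.sum_congr rfl fun a _ => this a, Finset.sum_const, Finset.card_univ,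
    ← Nat.cast_smul_eq_nsmul ℂ, smul_smul, inv_mul_cancel₀ card_ne_zero_complex, one_smul]

theorem weightProj_mul_of_ne (σ : A →* Module.End ℂ W) {χ ψ : A →* ℂˣ} (h : χ ≠ ψ) :
    weightProj σ χ * weightProj σ ψ = 0 := by
  conv_lhs => enter [1]; unfold weightProj
  rw [smul_mul_assoc, Finset.sum_mul]
  have : ∀ a : A, (((χ a⁻¹ : ℂˣ) : ℂ) • σ a) * weightProj σ ψ
      = (((χ⁻¹ * ψ) a : ℂˣ) : ℂ) • weightProj σ ψ := fun a => by
    rw [smul_mul_assoc, mul_weightProj, smul_smul, ← Units.val_mul]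
    simp
  rw [Finset.sum_congr rfl fun a _ => this a, ← Finset.sum_smul, sum_char_eq_zero, zero_smul,
    smul_zero]
  intro h'
  exact h (inv_mul_eq_one.mp h')

noncomputable instance : Fintype (A →* ℂˣ) :=
  Fintype.ofFinite _

theorem card_monoidHom_complex : Fintype.card (A →* ℂˣ) = Fintype.card A := by
  rw [← Nat.card_eq_fintype_card, ← Nat.card_eq_fintype_card]
  exact CommGroup.card_monoidHom_of_hasEnoughRootsOfUnity A ℂ

theorem exists_char_ne_one {a : A} (ha : a ≠ 1) : ∃ χ : A →* ℂˣ, χ a ≠ 1 :=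
  CommGroup.exists_apply_ne_one_of_hasEnoughRootsOfUnity A ℂ ha

theorem sum_apply_char_eq_zero {a : A} (ha : a ≠ 1) : ∑ χ : A →* ℂˣ, ((χ a : ℂˣ) : ℂ) = 0 := by
  obtain ⟨ψ, hψ⟩ := exists_char_ne_one ha
  have h : ((ψ a : ℂˣ) : ℂ) * ∑ χ : A →* ℂˣ, ((χ a : ℂˣ) : ℂ)
      = ∑ χ : A →* ℂˣ, ((χ a : ℂˣ) : ℂ) := by
    rw [Finset.mul_sum]
    refine Fintype.sum_equiv (Equiv.mulLeft ψ) _ _ fun χ => ?_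
    simp
  by_contra h0
  exact hψ (Units.ext (by simpa using mul_right_cancel₀ h0 (h.trans (one_mul _).symm)))

theorem sum_weightProj (σ : A →* Module.End ℂ W) : ∑ χ : A →* ℂˣ, weightProj σ χ = 1 := by
  unfold weightProj
  rw [← Finset.smul_sum, Finset.sum_comm]
  simp_rw [← Finset.sum_smul]
  rw [Finset.sum_eq_single 1 (fun a _ ha => by
    rw [sum_apply_char_eq_zero (inv_ne_one.mpr ha), zero_smul]) (by simp)]
  simp only [inv_one, map_one, Units.val_one, Finset.sum_const, Finset.card_univ,
    card_monoidHom_complex, nsmul_eq_mul, mul_one]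
  rw [smul_smul, inv_mul_cancel₀ card_ne_zero_complex, one_smul]

theorem norm_char_apply (χ : A →* ℂˣ) (a : A) : ‖((χ a : ℂˣ) : ℂ)‖ = 1 := by
  refine Complex.norm_eq_one_of_pow_eq_one (n := Fintype.card A) ?_ Fintype.card_ne_zero
  rw [← Units.val_pow_eq_pow_val, ← map_pow, pow_card_eq_one, map_one, Units.val_one]

open ComplexConjugate in
theorem sum_norm_sq_char_sum (s : (A →* ℂˣ) → ℂ) :
    ∑ a : A, ‖∑ χ : A →* ℂˣ, s χ * ((χ a : ℂˣ) : ℂ)‖ ^ 2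
      = Fintype.card A * ∑ χ : A →* ℂˣ, ‖s χ‖ ^ 2 := by
  have hconj : ∀ (χ : A →* ℂˣ) (a : A), conj ((χ a : ℂˣ) : ℂ) = ((χ⁻¹ a : ℂˣ) : ℂ) := fun χ a => by
    rw [← Complex.inv_eq_conj (norm_char_apply χ a)]
    simp
  apply Complex.ofReal_injective
  push_cast
  simp_rw [← Complex.mul_conj', map_sum, map_mul, hconj, Finset.sum_mul_sum]
  rw [Finset.sum_comm, Finset.mul_sum]
  refine Finset.sum_congr rfl fun χ _ => ?_
  rw [Finset.sum_comm, Finset.sum_eq_single χ]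
  · rw [Finset.sum_congr rfl (g := fun _ => s χ * conj (s χ))]
    · simp
    · intro a _
      rw [mul_mul_mul_comm, ← Units.val_mul, ← MonoidHom.mul_apply, mul_inv_cancel]
      simp
  · intro ψ _ hψ
    rw [Finset.sum_congr rfl (g := fun a => s χ * conj (s ψ) * (((χ * ψ⁻¹) a : ℂˣ) : ℂ))]
    · rw [← Finset.mul_sum, sum_char_eq_zero, mul_zero]
      exact fun h => hψ (mul_inv_eq_one.mp h).symm
    · intro a _
      rw [mul_mul_mul_comm, ← Units.val_mul, ← MonoidHom.mul_apply]
  · simp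

end WeightProj

section NormalAbelian

open scoped IsMulCommutative

variable {G W : Type*} [Group G] [AddCommGroup W] [Module ℂ W]
  {A : Subgroup G} [A.Normal]

/-- The conjugation action of a group on the linear characters of a normal subgroup. -/
def conjChar (g : G) (χ : A →* ℂˣ) : A →* ℂˣ :=
  χ.comp (MulAut.conjNormal g⁻¹).toMonoidHom

theorem conjChar_apply (g : G) (χ : A →* ℂˣ) (a : A) :
    conjChar g χ a = χ (MulAut.conjNormal g⁻¹ a) := rfl

theorem conjChar_mul (g h : G) (χ : A →* ℂˣ) :
    conjChar (g * h) χ = conjChar g (conjChar h χ) := by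
  ext a
  simp [conjChar_apply, map_mul, MulAut.mul_apply]

@[simp]
theorem conjChar_one_left (χ : A →* ℂˣ) : conjChar 1 χ = χ := by
  ext a
  simp [conjChar_apply]

theorem conjChar_map_mul (g : G) (χ ψ : A →* ℂˣ) :
    conjChar g (χ * ψ) = conjChar g χ * conjChar g ψ := rfl

@[simp]
theorem conjChar_map_one (g : G) : conjChar g (1 : A →* ℂˣ) = 1 := rfl

theorem conjChar_iterate (g : G) (n : ℕ) (χ : A →* ℂˣ) :
    (conjChar g)^[n] χ = conjChar (g ^ n) χ := by
  induction n with
  | zero => rw [Function.iterate_zero_apply, pow_zero, conjChar_one_left]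
  | succ n ih => rw [Function.iterate_succ_apply', ih, pow_succ', conjChar_mul]

theorem conjChar_of_mem_centralizer {g : G} (hg : g ∈ Subgroup.centralizer (A : Set G))
    (χ : A →* ℂˣ) : conjChar g χ = χ := by
  ext a
  rw [conjChar_apply]
  congr 2
  ext
  rw [MulAut.conjNormal_apply, inv_inv, mul_assoc, Subgroup.mem_centralizer_iff.mp hg a a.2,
    inv_mul_cancel_left]

variable [IsMulCommutative A] [Fintype A] (ρ : G →* Module.End ℂ W)

theorem mul_weightProj_conjChar (g : G) (χ : A →* ℂˣ) :
    ρ g * weightProj (ρ.comp A.subtype) χ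
      = weightProj (ρ.comp A.subtype) (conjChar g χ) * ρ g := by
  unfold weightProj
  rw [mul_smul_comm, smul_mul_assoc, Finset.mul_sum, Finset.sum_mul]
  congr 1
  refine Fintype.sum_equiv (MulAut.conjNormal g : A ≃* A).toEquiv _ _ fun a => ?_
  rw [mul_smul_comm, smul_mul_assoc, conjChar_apply]
  congr 1
  · simp
  · simp [← map_mul]

variable {ρ} in
theorem exists_conjChar_eq [Fintype G]
    (hs : ∀ f : Module.End ℂ W, (∀ g, f * ρ g = ρ g * f) → ∃ c : ℂ, f = c • 1)
    {χ ψ : A →* ℂˣ} (hχ : weightProj (ρ.comp A.subtype) χ ≠ 0)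
    (hψ : weightProj (ρ.comp A.subtype) ψ ≠ 0) : ∃ g : G, conjChar g χ = ψ := by
  classical
  by_contra! hne
  set e := weightProj (ρ.comp A.subtype) with he
  obtain ⟨c, hc⟩ := hs (∑ g : G, e (conjChar g χ)) fun h => by
    rw [Finset.sum_mul, Finset.mul_sum]
    symm
    refine Fintype.sum_equiv (Equiv.mulLeft h) _ _ fun g => ?_
    rw [mul_weightProj_conjChar, Equiv.coe_mulLeft, conjChar_mul]
  have h1 : e ψ * ∑ g : G, e (conjChar g χ) = 0 := by
    rw [Finset.mul_sum]
    exact Finset.sum_eq_zero fun g _ => weightProj_mul_of_ne _ (hne g).symm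
  have hc0 : c = 0 := by
    rw [hc, mul_smul_comm, mul_one] at h1
    exact (smul_eq_zero.mp h1).resolve_right hψ
  have h2 : e χ * ∑ g : G, e (conjChar g χ)
      = ((Finset.univ.filter fun g : G => conjChar g χ = χ).card : ℂ) • e χ := by
    rw [Finset.mul_sum, Nat.cast_smul_eq_nsmul, ← Finset.sum_const, Finset.sum_filter]
    refine Finset.sum_congr rfl fun g _ => ?_
    split_ifs with h
    · rw [h, weightProj_mul_self]
    · exact weightProj_mul_of_ne _ (Ne.symm h)
  rw [hc, hc0, zero_smul, mul_zero] at h2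
  rcases smul_eq_zero.mp h2.symm with h | h
  · rw [Nat.cast_eq_zero, Finset.card_eq_zero] at h
    exact Finset.notMem_empty (1 : G) (h ▸ by simp)
  · exact hχ h

theorem trace_conj_weightProj (g : G) (χ : A →* ℂˣ) :
    LinearMap.trace ℂ W (weightProj (ρ.comp A.subtype) (conjChar g χ))
      = LinearMap.trace ℂ W (weightProj (ρ.comp A.subtype) χ) := by
  have h : weightProj (ρ.comp A.subtype) (conjChar g χ)
      = ρ g * weightProj (ρ.comp A.subtype) χ * ρ g⁻¹ := by
    rw [mul_weightProj_conjChar, mul_assoc, ← map_mul, mul_inv_cancel, map_one, mul_one]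
  rw [h, LinearMap.trace_mul_comm, ← mul_assoc, ← map_mul, inv_mul_cancel, map_one, one_mul]

variable [FiniteDimensional ℂ W]

theorem trace_of_isIdempotentElem {e : Module.End ℂ W} (he : e * e = e) :
    LinearMap.trace ℂ W e = finrank ℂ (LinearMap.range e) := by
  refine LinearMap.IsProj.trace (p := LinearMap.range e) ⟨fun x => ⟨x, rfl⟩, ?_⟩
  rintro _ ⟨x, rfl⟩
  exact LinearMap.congr_fun he x

theorem finrank_range_eq_zero {e : Module.End ℂ W} (h : finrank ℂ (LinearMap.range e) = 0) :
    e = 0 := by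
  rwa [Submodule.finrank_eq_zero, LinearMap.range_eq_bot] at h

theorem eq_one_of_sq_mul_eq {m t n : ℤ} (hm : 0 < m) (ht : 0 < t) (hn : 1 < n)
    (hmt : 1 < t * m) (h : (t * m) ^ 2 + (n - 1) = n * (t * m ^ 2)) : m = 1 ∧ t = n - 1 := by
  have h1 : m ^ 2 * (t * (n - t)) = n - 1 := by linarith
  have h2 : 0 < n - t := by
    by_contra! h3
    have : m ^ 2 * (t * (n - t)) ≤ 0 :=
      mul_nonpos_of_nonneg_of_nonpos (by positivity) (mul_nonpos_of_nonneg_of_nonpos ht.le h3)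
    linarith
  have h3 : 0 ≤ (t - 1) * (n - t - 1) := mul_nonneg (by linarith) (by linarith)
  have hq : 0 < t * (n - t) := mul_pos ht h2
  have hm1 : m = 1 := by
    by_contra hne
    have : 2 ≤ m := by omega
    have h4 : 4 ≤ m ^ 2 := by nlinarith
    have h5 : 4 * (t * (n - t)) ≤ m ^ 2 * (t * (n - t)) := mul_le_mul_of_nonneg_right h4 hq.le
    linarith
  subst hm1
  refine ⟨rfl, ?_⟩
  have h4 : (t - 1) * (n - t - 1) = 0 := by linarith
  rcases mul_eq_zero.mp h4 with h | h <;> linarith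

variable {ρ} in
theorem weightProj_structure [Fintype G]
    (hs : ∀ f : Module.End ℂ W, (∀ g, f * ρ g = ρ g * f) → ∃ c : ℂ, f = c • 1)
    (hdim : 1 < finrank ℂ W) (hA : 1 < Fintype.card A)
    (hnorm : ∀ a : A, a ≠ 1 → ‖LinearMap.trace ℂ W (ρ a)‖ = 1) :
    finrank ℂ W = Fintype.card A - 1 ∧
      weightProj (ρ.comp A.subtype) (1 : A →* ℂˣ) = 0 ∧
      ∀ χ : A →* ℂˣ, χ ≠ 1 →
        finrank ℂ (LinearMap.range (weightProj (ρ.comp A.subtype) χ)) = 1 := by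
  classical
  set e := weightProj (ρ.comp A.subtype) with he
  set m : (A →* ℂˣ) → ℕ := fun χ => finrank ℂ (LinearMap.range (e χ)) with hm
  have htr : ∀ χ, LinearMap.trace ℂ W (e χ) = m χ := fun χ =>
    trace_of_isIdempotentElem (weightProj_mul_self _ χ)
  have hne : ∀ χ, m χ ≠ 0 → e χ ≠ 0 := fun χ h h0 => h (by simp [hm, h0])
  have htrace : ∀ a : A, LinearMap.trace ℂ W (ρ a) = ∑ χ, (m χ : ℂ) * ((χ a : ℂˣ) : ℂ) := by
    intro a
    rw [← mul_one (ρ a), ← sum_weightProj (ρ.comp A.subtype), Finset.mul_sum, map_sum]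
    refine Finset.sum_congr rfl fun χ _ => ?_
    have := mul_weightProj (ρ.comp A.subtype) χ a
    rw [MonoidHom.comp_apply, Subgroup.subtype_apply] at this
    rw [this, map_smul, htr, smul_eq_mul, mul_comm]
  have hsum : finrank ℂ W = ∑ χ, m χ := by
    have := htrace 1
    simp only [OneMemClass.coe_one, map_one, Units.val_one, mul_one, LinearMap.trace_one] at this
    exact_mod_cast this
  obtain ⟨χ₀, -, hχ₀⟩ : ∃ χ ∈ Finset.univ, m χ ≠ 0 := by
    refine Finset.exists_ne_zero_of_sum_ne_zero ?_
    omega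
  set S := Finset.univ.filter fun χ => m χ ≠ 0 with hS
  have hconst : ∀ χ ∈ S, m χ = m χ₀ := by
    intro χ hχ
    obtain ⟨g, hg⟩ := exists_conjChar_eq hs (hne χ₀ hχ₀) (hne χ (by simpa [hS] using hχ))
    have := trace_conj_weightProj ρ g χ₀
    rw [hg, htr, htr] at this
    exact_mod_cast this
  have hsum1 : ∑ χ, m χ = S.card * m χ₀ := by
    rw [← Finset.sum_filter_ne_zero, Finset.sum_congr rfl hconst, Finset.sum_const, smul_eq_mul]
  have hsum2 : ∑ χ, m χ ^ 2 = S.card * m χ₀ ^ 2 := by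
    rw [← Finset.sum_filter_of_ne (p := fun χ => m χ ≠ 0) (by simp),
      Finset.sum_congr rfl fun χ hχ => by rw [hconst χ hχ], Finset.sum_const, smul_eq_mul]
  have hpars := sum_norm_sq_char_sum fun χ : A →* ℂˣ => (m χ : ℂ)
  simp_rw [← htrace] at hpars
  rw [← Finset.add_sum_erase _ _ (Finset.mem_univ (1 : A)),
    Finset.sum_congr rfl (fun a ha => by rw [hnorm a (Finset.ne_of_mem_erase ha), one_pow]),
    Finset.sum_const, Finset.card_erase_of_mem (Finset.mem_univ _), Finset.card_univ] at hpars
  simp only [OneMemClass.coe_one, map_one, LinearMap.trace_one, Complex.norm_natCast,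
    nsmul_eq_mul, mul_one, Nat.cast_sub hA.le, Nat.cast_one] at hpars
  rw [hsum, hsum1] at hpars hdim
  have hpars' : ((S.card * m χ₀ : ℤ)) ^ 2 + (Fintype.card A - 1)
      = Fintype.card A * (S.card * (m χ₀ : ℤ) ^ 2) := by
    have h2 : (∑ χ, (m χ : ℝ) ^ 2) = S.card * (m χ₀ : ℝ) ^ 2 := by exact_mod_cast hsum2
    rw [h2] at hpars
    exact_mod_cast hpars
  have hS0 : 0 < S.card := Finset.card_pos.mpr ⟨χ₀, by simpa [hS] using hχ₀⟩
  obtain ⟨hm1, hS1⟩ := eq_one_of_sq_mul_eq (by exact_mod_cast Nat.pos_of_ne_zero hχ₀)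
    (by exact_mod_cast hS0) (by exact_mod_cast hA) (by exact_mod_cast hdim) hpars'
  have hm1' : m χ₀ = 1 := by exact_mod_cast hm1
  have hS1' : S.card = Fintype.card A - 1 := by omega
  have h1 : (1 : A →* ℂˣ) ∉ S := by
    intro h1
    have hsub : S ⊆ {1} := by
      intro χ hχ
      obtain ⟨g, hg⟩ := exists_conjChar_eq hs (hne 1 (by simpa [hS] using h1))
        (hne χ (by simpa [hS] using hχ))
      rw [conjChar_map_one] at hg
      simp [hg]
    have := Finset.card_le_card hsub
    rw [hm1', mul_one] at hdim
    simp at this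
    omega
  have hSeq : S = Finset.univ.erase 1 := by
    refine Finset.eq_of_subset_of_card_le (fun χ hχ => ?_) ?_
    · exact Finset.mem_erase.mpr ⟨fun h => h1 (h ▸ hχ), Finset.mem_univ _⟩
    · rw [Finset.card_erase_of_mem (Finset.mem_univ _), Finset.card_univ, card_monoidHom_complex,
        hS1']
  refine ⟨by rw [hsum, hsum1, hm1', mul_one, hS1'], finrank_range_eq_zero ?_, fun χ hχ => ?_⟩
  · exact of_not_not fun h => h1 (Finset.mem_filter.mpr ⟨Finset.mem_univ _, h⟩)
  · rw [← hm1']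
    exact hconst χ (by rw [hSeq]; exact Finset.mem_erase.mpr ⟨hχ, Finset.mem_univ _⟩)

end NormalAbelian

theorem exists_mul_mul_eq_smul {W : Type*} [AddCommGroup W] [Module ℂ W] {e : Module.End ℂ W}
    (hr : finrank ℂ (LinearMap.range e) = 1) (f : Module.End ℂ W) :
    ∃ c : ℂ, e * f * e = c • e := by
  obtain ⟨⟨v, hv⟩, -, hspan⟩ := finrank_eq_one_iff'.mp hr
  have hsp : ∀ w, ∃ d : ℂ, d • v = e w := fun w => by
    obtain ⟨d, hd⟩ := hspan ⟨e w, w, rfl⟩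
    exact ⟨d, congrArg Subtype.val hd⟩
  obtain ⟨c, hc⟩ := hsp (f v)
  refine ⟨c, LinearMap.ext fun w => ?_⟩
  obtain ⟨d, hd⟩ := hsp w
  rw [Module.End.mul_apply, Module.End.mul_apply, LinearMap.smul_apply, ← hd, map_smul, map_smul,
    ← hc, smul_comm]

theorem exists_eq_of_norm_sum_eq_card {ι : Type*} {S : Finset ι} {s : ι → ℂ}
    (hs : ∀ i ∈ S, ‖s i‖ = 1) (hsum : ‖∑ i ∈ S, s i‖ = S.card) :
    ∃ c : ℂ, ∀ i ∈ S, s i = c := by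
  rcases S.eq_empty_or_nonempty with rfl | hne
  · simp
  set T := ∑ i ∈ S, s i with hT
  have hT0 : ‖T‖ ≠ 0 := by
    rw [hsum]
    exact_mod_cast hne.card_pos.ne'
  have hT0' : (‖T‖ : ℂ) ≠ 0 := by exact_mod_cast hT0
  set u : ℂ := (starRingEnd ℂ) T / ‖T‖ with hu
  have hun : ‖u‖ = 1 := by
    rw [hu, norm_div, RCLike.norm_conj, Complex.norm_real, norm_norm, div_self hT0]
  have huT : u * T = ‖T‖ := by
    rw [hu, div_mul_eq_mul_div, Complex.conj_mul', sq, mul_div_assoc, div_self hT0', mul_one]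
  have hn : ∀ i ∈ S, ‖u * s i‖ = 1 := fun i hi => by rw [norm_mul, hun, hs i hi, one_mul]
  have hle : ∀ i ∈ S, (u * s i).re ≤ 1 := fun i hi => (Complex.re_le_norm _).trans (hn i hi).le
  have heq : ∑ i ∈ S, (u * s i).re = ∑ i ∈ S, (1 : ℝ) := by
    rw [← Complex.re_sum, ← Finset.mul_sum, huT, Complex.ofReal_re, hsum]
    simp
  refine ⟨u⁻¹, fun i hi => ?_⟩
  have hre := (Finset.sum_eq_sum_iff_of_le hle).mp heq i hi
  refine eq_inv_of_mul_eq_one_right ?_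
  have h2 := Complex.sq_norm_sub_sq_re (u * s i)
  rw [hn i hi, hre] at h2
  refine Complex.ext (by simpa using hre) ?_
  have : (u * s i).im ^ 2 = 0 := by linarith
  simpa using pow_eq_zero_iff two_ne_zero |>.mp this

section NormalAbelian

open scoped IsMulCommutative

variable {G W : Type*} [Group G] [AddCommGroup W] [Module ℂ W]
  {A : Subgroup G} [IsMulCommutative A] [Fintype A]
  {ρ : G →* Module.End ℂ W}

theorem trace_mul_eq_sum (g : G) (x : A) :
    LinearMap.trace ℂ W (ρ (g * x)) = ∑ χ : A →* ℂˣ,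
      LinearMap.trace ℂ W (ρ g * weightProj (ρ.comp A.subtype) χ) * ((χ x : ℂˣ) : ℂ) := by
  rw [← mul_one (ρ (g * x)), ← sum_weightProj (ρ.comp A.subtype), Finset.mul_sum, map_sum]
  refine Finset.sum_congr rfl fun χ _ => ?_
  have := mul_weightProj (ρ.comp A.subtype) χ x
  rw [MonoidHom.comp_apply, Subgroup.subtype_apply] at this
  rw [map_mul ρ, mul_assoc, this, mul_smul_comm, map_smul, smul_eq_mul, mul_comm]

variable [A.Normal]

theorem trace_mul_weightProj_of_ne {g : G} {χ : A →* ℂˣ} (h : conjChar g χ ≠ χ) :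
    LinearMap.trace ℂ W (ρ g * weightProj (ρ.comp A.subtype) χ) = 0 := by
  rw [← weightProj_mul_self, ← mul_assoc, LinearMap.trace_mul_comm, mul_weightProj_conjChar,
    ← mul_assoc, weightProj_mul_of_ne _ h.symm, zero_mul, map_zero]

variable [Fintype G] [FiniteDimensional ℂ W]

theorem mul_weightProj_of_eq {g : G} {χ : A →* ℂˣ} (h : conjChar g χ = χ)
    (hr : finrank ℂ (LinearMap.range (weightProj (ρ.comp A.subtype) χ)) = 1) :
    ∃ c : ℂ, ‖c‖ = 1 ∧
      ρ g * weightProj (ρ.comp A.subtype) χ = c • weightProj (ρ.comp A.subtype) χ ∧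
      LinearMap.trace ℂ W (ρ g * weightProj (ρ.comp A.subtype) χ) = c := by
  set e := weightProj (ρ.comp A.subtype) χ with he
  have hee : e * e = e := weightProj_mul_self _ _
  obtain ⟨c, hc⟩ := exists_mul_mul_eq_smul hr (ρ g)
  have hge : ρ g * e = c • e := by
    have h1 : ρ g * e = e * ρ g := by rw [he, mul_weightProj_conjChar, h]
    rw [← hc, ← h1, mul_assoc, hee]
  refine ⟨c, ?_, hge, ?_⟩
  · have hpow : ∀ k : ℕ, ρ (g ^ k) * e = c ^ k • e := by
      intro k
      induction k with
      | zero => simp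
      | succ k ih => rw [pow_succ, map_mul, mul_assoc, hge, mul_smul_comm, ih, smul_smul, pow_succ,
          mul_comm]
    have hne : e ≠ 0 := by
      intro h0
      rw [h0, LinearMap.range_zero, finrank_bot] at hr
      exact zero_ne_one hr
    refine Complex.norm_eq_one_of_pow_eq_one (n := orderOf g) ?_ (orderOf_pos g).ne'
    have h2 := hpow (orderOf g)
    rw [pow_orderOf_eq_one, map_one, one_mul] at h2
    exact (smul_left_injective ℂ hne (by simpa using h2)).symm
  · rw [hge, map_smul, trace_of_isIdempotentElem hee, hr]
    simp

open scoped Classical in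
theorem sum_norm_sq_trace_mul
    (h1 : weightProj (ρ.comp A.subtype) (1 : A →* ℂˣ) = 0)
    (hr : ∀ χ : A →* ℂˣ, χ ≠ 1 →
        finrank ℂ (LinearMap.range (weightProj (ρ.comp A.subtype) χ)) = 1) (g : G) :
    ∑ x : A, ‖LinearMap.trace ℂ W (ρ (g * x))‖ ^ 2 = Fintype.card A *
      ((Finset.univ.filter fun χ : A →* ℂˣ => χ ≠ 1 ∧ conjChar g χ = χ).card : ℝ) := by
  simp_rw [trace_mul_eq_sum]
  rw [sum_norm_sq_char_sum, Finset.card_filter]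
  push_cast
  congr 1
  refine Finset.sum_congr rfl fun χ _ => ?_
  split_ifs with h
  · obtain ⟨c, hc, -, htr⟩ := mul_weightProj_of_eq h.2 (hr χ h.1)
    rw [htr, hc, one_pow]
  · by_cases hχ : χ = 1
    · simp [hχ, h1]
    · rw [trace_mul_weightProj_of_ne fun h' => h ⟨hχ, h'⟩]
      simp

theorem exists_eq_smul_one_of_norm_trace
    (h1 : weightProj (ρ.comp A.subtype) (1 : A →* ℂˣ) = 0)
    (hr : ∀ χ : A →* ℂˣ, χ ≠ 1 →
        finrank ℂ (LinearMap.range (weightProj (ρ.comp A.subtype) χ)) = 1)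
    (hdim : finrank ℂ W = Fintype.card A - 1) {g : G}
    (hg : g ∈ Subgroup.centralizer (A : Set G))
    (hnorm : ‖LinearMap.trace ℂ W (ρ g)‖ = finrank ℂ W) : ∃ c : ℂ, ρ g = c • 1 := by
  classical
  choose! s hs using fun (χ : A →* ℂˣ) (hχ : χ ≠ 1) =>
    mul_weightProj_of_eq (conjChar_of_mem_centralizer hg χ) (hr χ hχ)
  have hsum : ∀ f : (A →* ℂˣ) → Module.End ℂ W, f 1 = 0 →
      ∑ χ, f χ = ∑ χ ∈ Finset.univ.erase 1, f χ := fun f hf => by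
    rw [← Finset.add_sum_erase _ _ (Finset.mem_univ 1), hf, zero_add]
  have hg' : ρ g = ∑ χ ∈ Finset.univ.erase (1 : A →* ℂˣ),
      ρ g * weightProj (ρ.comp A.subtype) χ := by
    rw [← hsum (fun χ => ρ g * weightProj (ρ.comp A.subtype) χ) (by rw [h1, mul_zero]),
      ← Finset.mul_sum, sum_weightProj, mul_one]
  obtain ⟨c, hc⟩ := exists_eq_of_norm_sum_eq_card (S := Finset.univ.erase (1 : A →* ℂˣ)) (s := s)
    (fun χ hχ => (hs χ (Finset.ne_of_mem_erase hχ)).1) (by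
      rw [Finset.card_erase_of_mem (Finset.mem_univ _), Finset.card_univ, card_monoidHom_complex,
        ← hdim, ← hnorm]
      conv_rhs => rw [hg', map_sum]
      rw [Finset.sum_congr rfl fun χ hχ => (hs χ (Finset.ne_of_mem_erase hχ)).2.2])
  refine ⟨c, ?_⟩
  rw [hg', ← sum_weightProj (ρ.comp A.subtype), hsum _ h1, Finset.smul_sum]
  refine Finset.sum_congr rfl fun χ hχ => ?_
  rw [(hs χ (Finset.ne_of_mem_erase hχ)).2.1, hc χ hχ]

end NormalAbelian

theorem exists_eq_smul_one_of_simple {G : Type} [Group G] [Fintype G] (V : FDRep ℂ G)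
    [Simple V] (f : Module.End ℂ V) (hf : ∀ g, f * V.ρ g = V.ρ g * f) :
    ∃ c : ℂ, f = c • 1 := by
  let F : V ⟶ V := ⟨⟨ModuleCat.ofHom f⟩, fun g => by
    ext x
    exact LinearMap.congr_fun (hf g) x⟩
  obtain ⟨c, hc⟩ := endomorphism_simple_eq_smul_id ℂ F
  refine ⟨c, ?_⟩
  have := congrArg (fun h : V ⟶ V => h.hom.hom.hom) hc
  exact this.symm

section SplitCentralExtension

variable {G : Type*} [Group G] [Finite G]

theorem eq_one_of_sq_eq_one_of_odd_card {H : Type*} [Group H] (hH : Odd (Nat.card H)) {x : H}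
    (hx : x ^ 2 = 1) : x = 1 := by
  have h1 : orderOf x ∣ 2 := orderOf_dvd_of_pow_eq_one hx
  have h2 : orderOf x ∣ Nat.card H := orderOf_dvd_natCard x
  rw [← orderOf_eq_one_iff]
  exact Nat.eq_one_of_dvd_coprimes (Nat.coprime_two_left.mpr hH) h1 h2

/-- A central extension of a symmetric group by a group of odd order splits as soon as the
centre embeds in an abelian group of odd order over a subgroup of index two. -/
theorem nonempty_mulEquiv_perm_prod_center {α B : Type*} [Finite α] [CommGroup B]
    (φ : G →* Equiv.Perm α) (hφ : Function.Surjective φ) (hker : φ.ker = Subgroup.center G)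
    (hZ : Odd (Nat.card (Subgroup.center G))) (hB : Odd (Nat.card B))
    {A : Subgroup G} (hA : A.index = 2) (f : A →* B) (hZA : Subgroup.center G ≤ A)
    (hf : ∀ (z : G) (hz : z ∈ Subgroup.center G), f ⟨z, hZA hz⟩ = 1 → z = 1) :
    Nonempty (G ≃* Equiv.Perm α × Subgroup.center G) := by
  classical
  have hZodd : ∀ z ∈ Subgroup.center G, z ^ 2 = 1 → z = 1 := fun z hz h =>
    congrArg Subtype.val (eq_one_of_sq_eq_one_of_odd_card hZ (x := ⟨z, hz⟩) (Subtype.ext h))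
  set ψ : G →* B := f.transfer with hψ
  set K := ψ.ker with hK
  have hKZ : ∀ z ∈ Subgroup.center G, z ∈ K → z = 1 := by
    intro z hz hzK
    have hconj : ∀ (k : ℕ) (g : G), g⁻¹ * z ^ k * g = z ^ k := fun k g => by
      rw [mul_assoc, ← Subgroup.mem_center_iff.mp ((Subgroup.center G).pow_mem hz k) g,
        inv_mul_cancel_left]
    have h1 := f.transfer_eq_pow z fun k g _ => hconj k g
    rw [MonoidHom.mem_ker.mp hzK] at h1
    simp_rw [hA] at h1
    exact hZodd z hz (hf _ ((Subgroup.center G).pow_mem hz 2) h1.symm)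
  have hKtop : K.map φ = ⊤ := by
    rw [eq_top_iff, ← Equiv.Perm.closure_isSwap, Subgroup.closure_le]
    rintro τ hτ
    have hτ2 : τ ^ 2 = 1 := by
      obtain ⟨x, y, -, rfl⟩ := hτ
      rw [sq, Equiv.swap_mul_self]
    obtain ⟨g, rfl⟩ := hφ τ
    have hg2 : g ^ 2 ∈ Subgroup.center G := by
      rw [← hker, MonoidHom.mem_ker, map_pow, hτ2]
    set n := Nat.card (Subgroup.center G) with hn
    have hgn : (g ^ n) ^ 2 = 1 := by
      rw [← pow_mul, mul_comm, pow_mul]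
      exact congrArg Subtype.val (pow_card_eq_one' (x := (⟨g ^ 2, hg2⟩ : Subgroup.center G)))
    refine ⟨g ^ n, ?_, ?_⟩
    · exact eq_one_of_sq_eq_one_of_odd_card hB (by rw [← map_pow, hgn, map_one])
    · obtain ⟨k, hk⟩ := hZ
      rw [map_pow, hk, pow_succ, pow_mul, hτ2, one_pow, one_mul]
  have hbij : Function.Bijective (φ.comp K.subtype) := by
    constructor
    · rw [injective_iff_map_eq_one]
      rintro ⟨k, hk⟩ h
      refine Subtype.ext (hKZ k ?_ hk)
      rw [← hker]
      exact h
    · intro τ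
      obtain ⟨k, hk, rfl⟩ := hKtop.ge (Subgroup.mem_top τ)
      exact ⟨⟨k, hk⟩, rfl⟩
  let e : K ≃* Equiv.Perm α := MulEquiv.ofBijective (φ.comp K.subtype) hbij
  have he : ∀ τ, φ (e.symm τ) = τ := fun τ => e.apply_symm_apply τ
  have hφZ : ∀ z : Subgroup.center G, φ z = 1 := fun z => by
    rw [← MonoidHom.mem_ker, hker]
    exact z.2
  let F : Equiv.Perm α × Subgroup.center G →* G :=
    MonoidHom.noncommCoprod (K.subtype.comp e.symm.toMonoidHom) (Subgroup.center G).subtype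
      fun k z => (Subgroup.mem_center_iff.mp z.2 _)
  have hF : ∀ τ z, F (τ, z) = e.symm τ * z := fun _ _ => rfl
  refine ⟨(MulEquiv.ofBijective F ⟨?_, fun g => ?_⟩).symm⟩
  · rw [injective_iff_map_eq_one]
    rintro ⟨τ, z⟩ h
    have h1 := congrArg φ h
    rw [hF, map_mul, he, hφZ, mul_one, map_one] at h1
    subst h1
    rw [hF, map_one, OneMemClass.coe_one, one_mul] at h
    exact Prod.ext rfl (Subtype.ext h)
  · have hmem : (e.symm (φ g) : G)⁻¹ * g ∈ Subgroup.center G := by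
      rw [← hker, MonoidHom.mem_ker, map_mul, map_inv, he, inv_mul_cancel]
    exact ⟨(φ g, ⟨_, hmem⟩), by rw [hF, mul_inv_cancel_left]⟩

end SplitCentralExtension

section KleinFour

variable {G : Type*} [Group G] [Finite G] {P : Subgroup G} [P.Normal]

theorem index_centralizer_dvd_six (hcard : Nat.card P = 4) :
    (Subgroup.centralizer (P : Set G)).index ∣ 6 := by
  let θ : G →* Equiv.Perm {x : P // x ≠ 1} := MonoidHom.mk'
    (fun g => (MulAut.conjNormal g : P ≃* P).toEquiv.subtypeEquiv fun x => by simp)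
    fun g h => by ext; simp [mul_assoc]
  have hle : θ.ker ≤ Subgroup.centralizer (P : Set G) := fun g hg => by
    rw [Subgroup.mem_centralizer_iff]
    intro x hx
    by_cases hx1 : x = 1
    · simp [hx1]
    have h1 := congrArg (fun y : {x : P // x ≠ 1} => (y : G))
      (Equiv.congr_fun (MonoidHom.mem_ker.mp hg) ⟨⟨x, hx⟩, fun h => hx1 (congrArg Subtype.val h)⟩)
    have h2 : g * x * g⁻¹ = x := h1
    exact (mul_inv_eq_iff_eq_mul.mp h2).symm
  have hc : Nat.card {x : P // x ≠ 1} = 3 := by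
    classical
    have := Fintype.ofFinite P
    rw [Nat.card_eq_fintype_card] at hcard ⊢
    rw [Fintype.card_subtype_compl, hcard, Fintype.card_subtype_eq]
  refine (Subgroup.index_dvd_of_le hle).trans ?_
  rw [Subgroup.index_ker]
  refine (Subgroup.card_subgroup_dvd_card _).trans ?_
  rw [Nat.card_perm, hc]
  decide

theorem sq_mem_centralizer_of_commute (hcard : Nat.card P = 4) {s x : G} (hx : x ∈ P)
    (hx1 : x ≠ 1) (hsx : s * x = x * s) : s ^ 2 ∈ Subgroup.centralizer (P : Set G) := by
  classical
  have := Fintype.ofFinite P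
  set σ : P ≃* P := MulAut.conjNormal s with hσ
  set x' : P := ⟨x, hx⟩ with hx'
  have hx1' : x' ≠ 1 := fun h => hx1 (congrArg Subtype.val h)
  have hσx : σ x' = x' := Subtype.ext (by
    rw [hσ, MulAut.conjNormal_apply, hsx, mul_inv_cancel_right])
  have hmain : ∀ y, σ (σ y) = y := by
    intro y
    by_contra hne
    have hy : σ y ≠ y := fun h => hne (by rw [h, h])
    have hy1 : y ≠ 1 := fun h => hy (by rw [h, map_one])
    have hyx : y ≠ x' := fun h => hy (by rw [h, hσx])
    have hcard5 : ({1, x', y, σ y, σ (σ y)} : Finset P).card = 5 := by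
      have a1 : σ y ≠ 1 := by simpa using hy1
      have a2 : σ y ≠ x' := fun h => hyx (σ.injective (h.trans hσx.symm))
      have a3 : σ (σ y) ≠ 1 := by simpa using hy1
      have a4 : σ (σ y) ≠ x' := fun h => a2 (σ.injective (h.trans hσx.symm))
      have a5 : σ (σ y) ≠ σ y := fun h => hy (σ.injective h)
      rw [Finset.card_insert_of_notMem, Finset.card_insert_of_notMem,
        Finset.card_insert_of_notMem, Finset.card_insert_of_notMem, Finset.card_singleton] <;>
      simp [hx1'.symm, hy1.symm, a1.symm, a3.symm, hyx.symm, a2.symm, a4.symm, hy.symm,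
        Ne.symm hne, a5.symm]
    have := Finset.card_le_univ ({1, x', y, σ y, σ (σ y)} : Finset P)
    rw [hcard5, ← Nat.card_eq_fintype_card, hcard] at this
    omega
  rw [Subgroup.mem_centralizer_iff]
  intro y hy
  have h1 := congrArg Subtype.val (hmain ⟨y, hy⟩)
  rw [hσ, MulAut.conjNormal_apply, MulAut.conjNormal_apply] at h1
  calc y * s ^ 2 = (s * (s * y * s⁻¹) * s⁻¹) * s ^ 2 := by rw [h1]
    _ = s ^ 2 * y := by simp [sq, mul_assoc]

theorem nonempty_mulEquiv_perm_four_prod_center (hcard : Nat.card P = 4)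
    (hC : Subgroup.centralizer (P : Set G) = P ⊔ Subgroup.center G)
    (hPZ : P ⊓ Subgroup.center G = ⊥) (hZ : Odd (Nat.card (Subgroup.center G)))
    (h2 : 2 ∣ P.index) (h3 : 3 ∣ (Subgroup.centralizer (P : Set G)).index) :
    Nonempty (G ≃* Equiv.Perm (Fin 4) × Subgroup.center G) := by
  classical
  set C := Subgroup.centralizer (P : Set G) with hCdef
  set Z := Subgroup.center G with hZdef
  have : Fact (Nat.Prime 3) := ⟨Nat.prime_three⟩
  have hPC : P ≤ C := hC ▸ le_sup_left
  have hZC : Z ≤ C := hC ▸ le_sup_right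
  have hmemC : ∀ c ∈ C, ∃ x ∈ P, ∃ z ∈ Z, x * z = c := fun c hc => by
    rw [hC] at hc
    exact Subgroup.mem_sup_of_normal_left.mp hc
  have hPZ' : ∀ x, x ∈ P → x ∈ Z → x = 1 := fun x hx hz => by
    have : x ∈ P ⊓ Z := ⟨hx, hz⟩
    rwa [hPZ, Subgroup.mem_bot] at this
  have hCcard : Nat.card C = 4 * Nat.card Z := by
    rw [← hcard, ← Nat.card_prod]
    refine (Nat.card_eq_of_bijective (fun q : P × Z => (⟨q.1 * q.2,
      C.mul_mem (hPC q.1.2) (hZC q.2.2)⟩ : C)) ⟨?_, ?_⟩).symm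
    · rintro ⟨x, z⟩ ⟨x', z'⟩ h
      have h1 : (x : G) * z = x' * z' := congrArg Subtype.val h
      have h2 : (x' : G)⁻¹ * x = z' * (z : G)⁻¹ := by
        rw [inv_mul_eq_iff_eq_mul, ← mul_assoc, ← h1, mul_inv_cancel_right]
      have h3 := hPZ' _ (P.mul_mem (P.inv_mem x'.2) x.2)
        (h2 ▸ Z.mul_mem z'.2 (Z.inv_mem z.2))
      have h4 : x' = x := Subtype.ext (inv_mul_eq_one.mp h3)
      subst h4
      exact Prod.ext rfl (Subtype.ext (mul_left_cancel h1))
    · rintro ⟨c, hc⟩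
      obtain ⟨x, hx, z, hz, rfl⟩ := hmemC c hc
      exact ⟨(⟨x, hx⟩, ⟨z, hz⟩), rfl⟩
  have hGC : Nat.card C * C.index = Nat.card G := C.card_mul_index
  have hGP : Nat.card P * P.index = Nat.card G := P.card_mul_index
  have hPidx : P.index = Nat.card Z * C.index := by
    rw [← hGC, hCcard, hcard, mul_assoc] at hGP
    exact Nat.eq_of_mul_eq_mul_left (by norm_num) hGP
  have hCidx : C.index = 6 := by
    refine Nat.dvd_antisymm (index_centralizer_dvd_six hcard) ?_
    have h2' : 2 ∣ C.index := by
      rw [hPidx] at h2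
      exact (Nat.coprime_two_left.mpr hZ).dvd_of_dvd_mul_left h2
    exact Nat.Coprime.mul_dvd_of_dvd_of_dvd (by norm_num : Nat.Coprime 2 3) h2' h3
  have hGcard : Nat.card G = 24 * Nat.card Z := by
    rw [← hGC, hCcard, hCidx]
    ring
  have hZidx : Z.index = 24 := by
    have := Z.card_mul_index
    rw [hGcard, mul_comm] at this
    exact Nat.eq_of_mul_eq_mul_right Nat.card_pos this
  have hCnormal : C.Normal := by rw [hC]; infer_instance
  have hcop : ∀ S : Sylow 3 G, Disjoint (S : Subgroup G) P := fun S =>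
    IsPGroup.disjoint_of_ne 3 2 (by norm_num) _ _ S.isPGroup'
      (IsPGroup.of_card (n := 2) (by rw [hcard]; norm_num))
  have hSC : ∀ S : Sylow 3 G, ¬ (S : Subgroup G) ≤ C := fun S hS =>
    S.not_dvd_index (h3.trans (Subgroup.index_dvd_of_le hS))
  -- the Sylow `3`-subgroups
  have hsyl : Nat.card (Sylow 3 G) = 4 := by
    obtain ⟨S⟩ : Nonempty (Sylow 3 G) := inferInstance
    have hmod := card_sylow_modEq_one 3 G
    have hdvd : Nat.card (Sylow 3 G) ∣ 8 := by
      have h24 : Nat.card (Sylow 3 G) ∣ 24 := by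
        rw [S.card_eq_index_normalizer, ← hZidx]
        exact Subgroup.index_dvd_of_le (Subgroup.center_le_normalizer _)
      have hc3 : Nat.Coprime (Nat.card (Sylow 3 G)) 3 := by
        rw [Nat.coprime_comm, Nat.Prime.coprime_iff_not_dvd Nat.prime_three]
        exact not_dvd_card_sylow 3 G
      exact hc3.dvd_of_dvd_mul_right (n := 3) (m := 8) h24
    have hne1 : Nat.card (Sylow 3 G) ≠ 1 := by
      intro h1
      have hsub : Subsingleton (Sylow 3 G) := (Nat.card_eq_one_iff_unique.mp h1).1
      have hn : (S : Subgroup G).Normal := Sylow.normal_of_subsingleton S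
      refine hSC S fun s hs => Subgroup.mem_centralizer_iff.mpr fun x hx => ?_
      exact (Subgroup.commute_of_normal_of_disjoint _ _ hn inferInstance (hcop S) s x hs hx).symm
    have hle : Nat.card (Sylow 3 G) ≤ 8 := Nat.le_of_dvd (by norm_num) hdvd
    generalize Nat.card (Sylow 3 G) = n at *
    interval_cases n <;> revert hmod hdvd hne1 <;> decide
  let φ : G →* Equiv.Perm (Sylow 3 G) := MulAction.toPermHom G (Sylow 3 G)
  have hφ : ∀ g, g ∈ φ.ker ↔ ∀ S : Sylow 3 G, g • S = S := fun g => by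
    rw [MonoidHom.mem_ker, Equiv.ext_iff]
    rfl
  have hφZ : Z ≤ φ.ker := fun z hz => by
    rw [hφ]
    intro S
    exact Sylow.smul_eq_iff_mem_normalizer.mpr (Subgroup.center_le_normalizer _ hz)
  have hφP : Disjoint φ.ker P := by
    rw [Subgroup.disjoint_def]
    intro x hxk hx
    by_contra hx1
    obtain ⟨S⟩ : Nonempty (Sylow 3 G) := inferInstance
    obtain ⟨s, hs, hsC⟩ := SetLike.not_le_iff_exists.mp (hSC S)
    have hxn := Sylow.smul_eq_iff_mem_normalizer.mp ((hφ x).mp hxk S)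
    have hcomm : s * x * s⁻¹ * x⁻¹ = 1 := by
      refine Subgroup.disjoint_def.mp (hcop S) ?_ ?_
      · have : s * x * s⁻¹ * x⁻¹ = s * (x * s⁻¹ * x⁻¹) := by group
        rw [this]
        exact mul_mem hs ((Subgroup.mem_normalizer_iff.mp hxn _).mp (inv_mem hs))
      · exact P.mul_mem (Subgroup.Normal.conj_mem inferInstance x hx s) (P.inv_mem hx)
    have hsx : s * x = x * s := by
      rwa [mul_inv_eq_one, mul_inv_eq_iff_eq_mul] at hcomm
    have h2 := sq_mem_centralizer_of_commute hcard hx hx1 hsx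
    obtain ⟨k, hk⟩ := S.isPGroup' ⟨s, hs⟩
    have hsk : s ^ 3 ^ k = 1 := congrArg Subtype.val hk
    refine hsC ?_
    obtain ⟨j, hj⟩ : Odd (3 ^ k) := Odd.pow (by decide)
    have h5 : s = s⁻¹ ^ (2 * j) := by
      rw [inv_pow, eq_inv_iff_mul_eq_one, ← pow_succ', ← hj, hsk]
    rw [h5, inv_pow, pow_mul]
    exact C.inv_mem (C.pow_mem h2 j)
  have hker : φ.ker = Z := by
    refine le_antisymm (fun n hn => ?_) hφZ
    have hnC : n ∈ C := Subgroup.mem_centralizer_iff.mpr fun x hx =>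
      (Subgroup.commute_of_normal_of_disjoint _ _ inferInstance inferInstance hφP n x hn hx).symm
    obtain ⟨x, hx, z, hz, rfl⟩ := hmemC n hnC
    have hxk : x ∈ φ.ker := by
      have := φ.ker.mul_mem hn (φ.ker.inv_mem (hφZ hz))
      rwa [mul_inv_cancel_right] at this
    rw [Subgroup.disjoint_def.mp hφP hxk hx, one_mul]
    exact hz
  have hsurj : Function.Surjective φ := by
    rw [← MonoidHom.range_eq_top]
    refine Subgroup.eq_top_of_card_eq _ ?_
    rw [← Subgroup.index_ker, hker, hZidx, Nat.card_perm, hsyl]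
    rfl
  -- the subgroup of index two and its abelian quotient
  obtain ⟨T, hT⟩ : ∃ T : Subgroup (G ⧸ C), Nat.card T = 3 := by
    have := Sylow.exists_subgroup_card_pow_prime (G := G ⧸ C) 3 (n := 1) (by
      rw [pow_one]; exact h3)
    simpa using this
  set π := QuotientGroup.mk' C with hπ
  set A := T.comap π with hA
  have hTidx : T.index = 2 := by
    have h6 := T.card_mul_index
    rw [hT, show Nat.card (G ⧸ C) = 6 from hCidx] at h6
    omega
  have hAidx : A.index = 2 := by
    rw [hA, Subgroup.index_comap_of_surjective _ (QuotientGroup.mk'_surjective C), hTidx]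
  have hCA : C ≤ A := fun c hc => by
    rw [hA, Subgroup.mem_comap, hπ, QuotientGroup.mk'_apply, (QuotientGroup.eq_one_iff c).mpr hc]
    exact T.one_mem
  have hPA : P ≤ A := hPC.trans hCA
  let B := A ⧸ P.subgroupOf A
  let f : B →* T := QuotientGroup.lift (P.subgroupOf A) (π.subgroupComap T) fun a ha =>
    Subtype.ext ((QuotientGroup.eq_one_iff (a : G)).mpr (hPC ha))
  have : IsCyclic T := isCyclic_of_prime_card hT
  have hfker : f.ker ≤ Subgroup.center B := by
    intro b hb
    obtain ⟨a, rfl⟩ := QuotientGroup.mk_surjective b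
    have haC : (a : G) ∈ C :=
      (QuotientGroup.eq_one_iff (a : G)).mp (congrArg Subtype.val (MonoidHom.mem_ker.mp hb))
    obtain ⟨x, hx, z, hz, hxz⟩ := hmemC a haC
    rw [Subgroup.mem_center_iff]
    intro b'
    obtain ⟨a', rfl⟩ := QuotientGroup.mk_surjective b'
    have ha : (a : B) = ((⟨z, hCA (hZC hz)⟩ : A) : B) := by
      rw [QuotientGroup.eq_iff_div_mem, Subgroup.mem_subgroupOf]
      change (a : G) / z ∈ P
      rwa [← hxz, mul_div_cancel_right]
    rw [ha, ← QuotientGroup.mk_mul, ← QuotientGroup.mk_mul]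
    exact congrArg _ (Subtype.ext (Subgroup.mem_center_iff.mp hz a'))
  let : CommGroup B := commGroupOfCyclicCenterQuotient f hfker
  have hBodd : Odd (Nat.card B) := by
    have h1 : Nat.card B * 2 = P.index := by
      rw [← hAidx]
      exact Subgroup.relIndex_mul_index hPA
    rw [hPidx, hCidx] at h1
    have h4 : Nat.card B = Nat.card Z * 3 := by omega
    rw [h4]
    exact hZ.mul (by decide)
  obtain ⟨e⟩ := nonempty_mulEquiv_perm_prod_center φ hsurj hker hZ hBodd hAidx
    (QuotientGroup.mk' (P.subgroupOf A)) (hZC.trans hCA) fun z hz h => hPZ' z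
      ((QuotientGroup.eq_one_iff (N := P.subgroupOf A) _).mp h) hz
  have := Fintype.ofFinite (Sylow 3 G)
  let ε : Sylow 3 G ≃ Fin 4 := Finite.equivFinOfCardEq hsyl
  exact ⟨e.trans (ε.permCongrHom.prodCongr (MulEquiv.refl _))⟩

end KleinFour

section Faithful

variable {G W : Type*} [Group G] [AddCommGroup W] [Module ℂ W] {ρ : G →* Module.End ℂ W}

theorem mem_center_of_eq_smul_one (hinj : ∀ g, ρ g = 1 → g = 1) {g : G} {c : ℂ}
    (hg : ρ g = c • 1) : g ∈ Subgroup.center G := by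
  rw [Subgroup.mem_center_iff]
  intro h
  have h1 : ρ (h * g) = ρ (g * h) := by simp [hg]
  have h2 : ρ ((g * h)⁻¹ * (h * g)) = 1 := by
    rw [map_mul, h1, ← map_mul, inv_mul_cancel, map_one]
  exact (inv_mul_eq_one.mp (hinj _ h2)).symm

theorem norm_trace_of_mem_center [Finite G] [FiniteDimensional ℂ W]
    (hs : ∀ f : Module.End ℂ W, (∀ g, f * ρ g = ρ g * f) → ∃ c : ℂ, f = c • 1)
    (hdim : 1 < finrank ℂ W) {z : G} (hz : z ∈ Subgroup.center G) :
    ‖LinearMap.trace ℂ W (ρ z)‖ = finrank ℂ W := by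
  have : Nontrivial W := nontrivial_of_finrank_pos (zero_lt_one.trans hdim)
  obtain ⟨c, hc⟩ := hs (ρ z) fun g => by
    rw [← map_mul, ← map_mul, Subgroup.mem_center_iff.mp hz g]
  have hcpow : c ^ orderOf z = 1 := by
    have h : (c ^ orderOf z) • (1 : Module.End ℂ W) = (1 : ℂ) • 1 := by
      rw [← one_pow (M := Module.End ℂ W) (orderOf z), ← smul_pow, ← hc, ← map_pow,
        pow_orderOf_eq_one, map_one, one_pow, one_smul]
    exact smul_left_injective ℂ one_ne_zero h
  rw [hc, map_smul, smul_eq_mul, norm_mul,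
    Complex.norm_eq_one_of_pow_eq_one hcpow (orderOf_pos z).ne', one_mul, LinearMap.trace_one]
  simp

theorem not_dvd_orderOf_of_mem_center [Finite G] [FiniteDimensional ℂ W]
    (hs : ∀ f : Module.End ℂ W, (∀ g, f * ρ g = ρ g * f) → ∃ c : ℂ, f = c • 1)
    (hdim : 1 < finrank ℂ W) {p : ℕ}
    (hnorm : ∀ x, p ∣ orderOf x → ‖LinearMap.trace ℂ W (ρ x)‖ = 1) {z : G}
    (hz : z ∈ Subgroup.center G) : ¬ p ∣ orderOf z := fun h => by
  have h1 := norm_trace_of_mem_center hs hdim hz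
  rw [hnorm z h] at h1
  have : (1 : ℝ) < finrank ℂ W := by exact_mod_cast hdim
  linarith

end Faithful

theorem IsPGroup.dvd_orderOf_of_mem {G : Type*} [Group G] {p : ℕ} (hp : p.Prime)
    {A : Subgroup G} (hA : IsPGroup p A) {a : G} (ha : a ∈ A) (h1 : a ≠ 1) :
    p ∣ orderOf a := by
  obtain ⟨k, hk⟩ := hA ⟨a, ha⟩
  have hk' : a ^ p ^ k = 1 := congrArg Subtype.val hk
  obtain ⟨m, -, hm⟩ := (Nat.dvd_prime_pow hp).mp (orderOf_dvd_of_pow_eq_one hk')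
  rcases m.eq_zero_or_pos with rfl | hm0
  · exact absurd (orderOf_eq_one_iff.mp (by rw [hm, pow_zero])) h1
  · exact hm ▸ dvd_pow_self p hm0.ne'

theorem dvd_orderOf_mul_of_commute {G : Type*} [Group G] {p : ℕ} (hp : p.Prime)
    {A : Subgroup G} (hA : IsPGroup p A) {y a : G} (hy : ¬ p ∣ orderOf y) (ha : a ∈ A)
    (h1 : a ≠ 1) (hya : Commute y a) : p ∣ orderOf (y * a) := by
  obtain ⟨k, hk⟩ := hA ⟨a, ha⟩
  have hk' : a ^ p ^ k = 1 := congrArg Subtype.val hk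
  have hcop : (orderOf y).Coprime (orderOf a) :=
    Nat.Coprime.coprime_dvd_right (orderOf_dvd_of_pow_eq_one hk')
      (((Nat.Prime.coprime_iff_not_dvd hp).mpr hy).symm.pow_right k)
  rw [hya.orderOf_mul_eq_mul_orderOf_of_coprime hcop]
  exact (hA.dvd_orderOf_of_mem hp ha h1).mul_left _

theorem eq_two_and_card_le_four {D : Type*} [CommGroup D] [Finite D] {p : ℕ} (hp : p.Prime)
    (hpow : ∀ x : D, x ^ p = 1) {σ : D →* D} {x₀ : D}
    (hfix : ∀ x, x ≠ 1 ∧ σ x = x ↔ x = x₀) (hσ : ∀ x, σ^[p] x = x) :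
    p = 2 ∧ Nat.card D ≤ 4 := by
  obtain ⟨h1, h2⟩ := (hfix x₀).mpr rfl
  have hinv : x₀⁻¹ = x₀ := (hfix _).mp ⟨inv_ne_one.mpr h1, by rw [map_inv, h2]⟩
  have hsq : x₀ ^ 2 = 1 := by rw [sq, mul_eq_one_iff_inv_eq, hinv]
  have hp2 : p = 2 := by
    have := Fact.mk hp
    rw [← orderOf_eq_prime hsq h1 (p := 2), orderOf_eq_prime (hpow x₀) h1]
  subst hp2
  refine ⟨rfl, ?_⟩
  have hself : ∀ x : D, x⁻¹ = x := fun x => by rw [← mul_eq_one_iff_inv_eq, ← sq, hpow]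
  let N : D →* D := MonoidHom.id D * σ
  have hfixed : ∀ x, σ x = x → x ∈ ({1, x₀} : Set D) := by
    intro x hx
    by_cases h : x = 1
    · exact Or.inl h
    · exact Or.inr ((hfix x).mp ⟨h, hx⟩)
  have hker : (N.ker : Set D) ⊆ {1, x₀} := fun x hx => hfixed x <| by
    have : x * σ x = 1 := MonoidHom.mem_ker.mp hx
    rw [← inv_eq_of_mul_eq_one_right this, hself]
  have hrange : (N.range : Set D) ⊆ {1, x₀} := by
    rintro _ ⟨x, rfl⟩
    refine hfixed _ ?_
    have : σ (σ x) = x := hσ x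
    change σ (x * σ x) = x * σ x
    rw [map_mul, this, mul_comm]
  have hle : ∀ H : Subgroup D, (H : Set D) ⊆ {1, x₀} → Nat.card H ≤ 2 :=
    fun H hH => (Set.ncard_le_ncard hH (Set.toFinite _)).trans <| by
      simpa using Set.ncard_insert_le (1 : D) {x₀}
  rw [← N.ker.card_mul_index, Subgroup.index_ker]
  exact Nat.mul_le_mul (hle _ hker) (hle _ hrange)

section NormalAbelian

open scoped IsMulCommutative

variable {G W : Type*} [Group G] [AddCommGroup W] [Module ℂ W] [Finite G]
  {A : Subgroup G} [A.Normal] [IsMulCommutative A] {p : ℕ}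
  {ρ : G →* Module.End ℂ W}

theorem exists_conjChar_eq_of_finrank_range [Fintype A]
    (hs : ∀ f : Module.End ℂ W, (∀ g, f * ρ g = ρ g * f) → ∃ c : ℂ, f = c • 1)
    {χ ψ : A →* ℂˣ} (hχ : finrank ℂ (LinearMap.range (weightProj (ρ.comp A.subtype) χ)) = 1)
    (hψ : finrank ℂ (LinearMap.range (weightProj (ρ.comp A.subtype) ψ)) = 1) :
    ∃ g : G, conjChar g χ = ψ := by
  have := Fintype.ofFinite G
  refine exists_conjChar_eq hs (fun h => ?_) fun h => ?_
  · rw [h, LinearMap.range_zero, finrank_bot] at hχ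
    exact zero_ne_one hχ
  · rw [h, LinearMap.range_zero, finrank_bot] at hψ
    exact zero_ne_one hψ

variable [FiniteDimensional ℂ W]

theorem centralizer_le_sup_center [Fintype A] (hp : p.Prime) (hA : IsPGroup p A)
    (hinj : ∀ g, ρ g = 1 → g = 1) (hdim : 1 < finrank ℂ W)
    (hnorm : ∀ x, p ∣ orderOf x → ‖LinearMap.trace ℂ W (ρ x)‖ = 1)
    (hcard : finrank ℂ W = Fintype.card A - 1)
    (h1 : weightProj (ρ.comp A.subtype) (1 : A →* ℂˣ) = 0)
    (hr : ∀ χ : A →* ℂˣ, χ ≠ 1 →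
        finrank ℂ (LinearMap.range (weightProj (ρ.comp A.subtype) χ)) = 1) :
    Subgroup.centralizer (A : Set G) ≤ A ⊔ Subgroup.center G := by
  classical
  have := Fintype.ofFinite G
  intro c hc
  have hA2 : (2 : ℝ) < Fintype.card A := by
    have : 2 < Fintype.card A := by omega
    exact_mod_cast this
  have hdimR : (finrank ℂ W : ℝ) = Fintype.card A - 1 := by
    rw [hcard, Nat.cast_sub (by omega), Nat.cast_one]
  have hsum : ∑ x : A, ‖LinearMap.trace ℂ W (ρ (c * x))‖ ^ 2
      = Fintype.card A * ((Fintype.card A : ℝ) - 1) := by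
    rw [sum_norm_sq_trace_mul h1 hr]
    congr 1
    simp_rw [conjChar_of_mem_centralizer hc, and_true, Finset.filter_ne']
    rw [Finset.card_erase_of_mem (Finset.mem_univ _), Finset.card_univ, card_monoidHom_complex,
      Nat.cast_sub (by omega), Nat.cast_one]
  obtain ⟨x₀, hx₀⟩ : ∃ x₀ : A, ¬ p ∣ orderOf (c * x₀) := by
    by_contra! hall
    rw [Finset.sum_congr rfl fun x _ => by rw [hnorm _ (hall x), one_pow], Finset.sum_const,
      Finset.card_univ, nsmul_one] at hsum
    nlinarith
  have hx : ∀ x : A, x ≠ x₀ → ‖LinearMap.trace ℂ W (ρ (c * x))‖ ^ 2 = 1 := by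
    intro x hne
    have hmem : ((x₀⁻¹ * x : A) : G) ∈ A := (x₀⁻¹ * x).2
    have := dvd_orderOf_mul_of_commute hp hA hx₀ hmem
      (fun h => hne (inv_mul_eq_one.mp (Subtype.ext h)).symm)
      (Commute.mul_left (Subgroup.mem_centralizer_iff.mp hc _ hmem).symm
        (congrArg Subtype.val (mul_comm x₀ (x₀⁻¹ * x))))
    rw [Subgroup.coe_mul, Subgroup.coe_inv, mul_assoc, mul_inv_cancel_left] at this
    rw [hnorm _ this, one_pow]
  rw [← Finset.add_sum_erase _ _ (Finset.mem_univ x₀),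
    Finset.sum_congr rfl fun x hx' => hx x (Finset.ne_of_mem_erase hx'), Finset.sum_const,
    Finset.card_erase_of_mem (Finset.mem_univ _), Finset.card_univ, nsmul_one,
    Nat.cast_sub (by omega), Nat.cast_one] at hsum
  have hx₀n : ‖LinearMap.trace ℂ W (ρ (c * x₀))‖ = finrank ℂ W := by
    rw [hdimR]
    refine (pow_left_inj₀ (norm_nonneg _) (by linarith) two_ne_zero).mp ?_
    linarith
  obtain ⟨d, hd⟩ := exists_eq_smul_one_of_norm_trace h1 hr hcard (mul_mem hc
    (Subgroup.mem_centralizer_iff.mpr fun y hy =>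
      congrArg Subtype.val (mul_comm (⟨y, hy⟩ : A) x₀))) hx₀n
  rw [← mul_inv_cancel_right c (x₀ : G)]
  exact mul_mem (Subgroup.mem_sup_right (mem_center_of_eq_smul_one hinj hd))
    (Subgroup.mem_sup_left (inv_mem x₀.2))

theorem pow_eq_one_of_conjChar_transitive [Fintype A] (hp : p.Prime) (hA : IsPGroup p A)
    (hA1 : 1 < Fintype.card A)
    (htrans : ∀ χ ψ : A →* ℂˣ, χ ≠ 1 → ψ ≠ 1 → ∃ g : G, conjChar g χ = ψ) :
    (∀ χ : A →* ℂˣ, χ ^ p = 1) ∧ ∀ a : A, a ^ p = 1 := by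
  have := Fact.mk hp
  have hdvd : p ∣ Fintype.card (A →* ℂˣ) := by
    rw [card_monoidHom_complex]
    obtain ⟨n, hn⟩ := IsPGroup.iff_card.mp hA
    rw [Nat.card_eq_fintype_card] at hn
    rcases n.eq_zero_or_pos with rfl | hn0
    · simp [hn] at hA1
    · exact hn ▸ dvd_pow_self p hn0.ne'
  obtain ⟨χ₀, hχ₀⟩ := exists_prime_orderOf_dvd_card p hdvd
  have hχ₀1 : χ₀ ≠ 1 := fun h => by
    rw [h, orderOf_one] at hχ₀
    exact hp.one_lt.ne hχ₀
  have hpow : ∀ χ : A →* ℂˣ, χ ^ p = 1 := by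
    intro χ
    by_cases hχ : χ = 1
    · rw [hχ]
      exact one_pow (M := A →* ℂˣ) p
    · obtain ⟨g, rfl⟩ := htrans χ₀ χ hχ₀1 hχ
      have : χ₀ ^ p = 1 := hχ₀ ▸ pow_orderOf_eq_one χ₀
      ext a
      have h2 := DFunLike.congr_fun this (MulAut.conjNormal g⁻¹ a)
      rw [MonoidHom.pow_apply] at h2 ⊢
      rw [conjChar_apply, h2, MonoidHom.one_apply, MonoidHom.one_apply]
  refine ⟨hpow, fun a => ?_⟩
  by_contra ha
  obtain ⟨χ, hχ⟩ := exists_char_ne_one ha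
  rw [map_pow, ← MonoidHom.pow_apply, hpow, MonoidHom.one_apply] at hχ
  exact hχ rfl

open scoped Classical in
theorem card_eq_four_of_unique_fixed [Fintype A] (hp : p.Prime) (hA : IsPGroup p A)
    (hA2 : 2 < Fintype.card A) (hpow : ∀ χ : A →* ℂˣ, χ ^ p = 1) {g : G} (hg : g ^ p ∈ A)
    (hfix : (Finset.univ.filter fun χ : A →* ℂˣ => χ ≠ 1 ∧ conjChar g χ = χ).card = 1) :
    p = 2 ∧ Fintype.card A = 4 := by
  obtain ⟨χ₀, h₀⟩ := Finset.card_eq_one.mp hfix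
  obtain ⟨rfl, hcard⟩ := eq_two_and_card_le_four (D := A →* ℂˣ) hp hpow
    (σ := MonoidHom.mk' (conjChar g) (conjChar_map_mul g)) (x₀ := χ₀)
    (fun χ => by
      have := Finset.ext_iff.mp h₀ χ
      rwa [Finset.mem_filter, Finset.mem_singleton, and_iff_right (Finset.mem_univ χ)] at this)
    fun χ => (conjChar_iterate g p χ).trans
      (conjChar_of_mem_centralizer (Subgroup.le_centralizer A hg) χ)
  rw [Nat.card_eq_fintype_card, card_monoidHom_complex] at hcard
  refine ⟨rfl, ?_⟩
  have := Fact.mk hp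
  obtain ⟨n, hn⟩ := IsPGroup.iff_card.mp hA
  rw [Nat.card_eq_fintype_card] at hn
  have : n ≤ 2 := (Nat.pow_le_pow_iff_right (a := 2) one_lt_two).mp (by rw [← hn]; exact hcard)
  interval_cases n <;> omega

theorem card_sub_one_dvd_index_centralizer [Fintype A] (hA : 1 < Fintype.card A)
    (htrans : ∀ χ ψ : A →* ℂˣ, χ ≠ 1 → ψ ≠ 1 → ∃ g : G, conjChar g χ = ψ) :
    Fintype.card A - 1 ∣ (Subgroup.centralizer (A : Set G)).index := by
  let act : MulAction G (A →* ℂˣ) :=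
    { smul := conjChar
      one_smul := conjChar_one_left
      mul_smul := conjChar_mul }
  obtain ⟨χ, hχ⟩ : ∃ χ : A →* ℂˣ, χ ≠ 1 := by
    have := Fintype.one_lt_card_iff_nontrivial.mp (card_monoidHom_complex (A := A) ▸ hA)
    exact exists_ne 1
  have horb : MulAction.orbit G χ = {1}ᶜ := by
    ext ψ
    refine ⟨?_, fun hψ => htrans χ ψ hχ hψ⟩
    rintro ⟨g, rfl⟩ (h : conjChar g χ = 1)
    refine hχ ?_
    rw [← conjChar_one_left χ, ← inv_mul_cancel g, conjChar_mul, h, conjChar_map_one]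
  have hidx := MulAction.index_stabilizer G χ
  rw [horb, Set.ncard_compl, Set.ncard_singleton, Nat.card_eq_fintype_card,
    card_monoidHom_complex] at hidx
  rw [← hidx]
  exact Subgroup.index_dvd_of_le fun g hg =>
    MulAction.mem_stabilizer_iff.mpr (conjChar_of_mem_centralizer hg χ)

end NormalAbelian

/-- **Theorem B / Theorem 2.5** (Navarro–Robinson). Let `χ` be a faithful non-linear
irreducible complex character of a finite group `G` taking root of unity values on all
`p`-singular elements, and let `P = O_p(G)` (the largest normal `p`-subgroup) be
non-trivial. Then either `P` is an elementary abelian Sylow `p`-subgroup,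
`C_G(P) = P × Z(G)`, the conjugation action of `G` (equivalently, of `G/C_G(P)`) on the
non-trivial irreducible characters of `P` is transitive and `χ(1) = |P| - 1`; or `p = 2`
and `G = S₄ × Z(G)` with `|Z(G)|` odd. -/
theorem stmt_10 {G : Type} [Group G] [Fintype G] (p : ℕ) (hp : p.Prime)
    (V : FDRep ℂ G) (hV : Simple V)
    (hfaithful : ∀ g : G, V.character g = V.character 1 → g = 1)
    (hnonlinear : 1 < finrank ℂ V)
    (hroot : ∀ x : G, p ∣ orderOf x → ∃ n : ℕ, 0 < n ∧ V.character x ^ n = 1)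
    (P : Subgroup G) (hPnormal : P.Normal) (hPp : IsPGroup p P)
    (hPmax : ∀ Q : Subgroup G, Q.Normal → IsPGroup p Q → Q ≤ P)
    (hPne : P ≠ ⊥) :
    (((∀ a b : P, a * b = b * a) ∧ (∀ a : P, a ^ p = 1)) ∧
      ¬ p ∣ P.index ∧
      Subgroup.centralizer (P : Set G) = P ⊔ Subgroup.center G ∧
      P ⊓ Subgroup.center G = ⊥ ∧
      (∀ lam mu : P →* ℂ, lam ≠ 1 → mu ≠ 1 →
        ∃ g : G, ∀ (x : G) (hx : x ∈ P) (hx' : g⁻¹ * x * g ∈ P),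
          mu ⟨x, hx⟩ = lam ⟨g⁻¹ * x * g, hx'⟩) ∧
      finrank ℂ V = Nat.card P - 1) ∨
    (p = 2 ∧ Odd (Nat.card (Subgroup.center G)) ∧
      Nonempty (G ≃* Equiv.Perm (Fin 4) × Subgroup.center G)) := by
  classical
  have := Fact.mk hp
  set ρ : G →* Module.End ℂ V := V.ρ with hρ
  have hs : ∀ f : Module.End ℂ V, (∀ g, f * ρ g = ρ g * f) → ∃ c : ℂ, f = c • 1 :=
    exists_eq_smul_one_of_simple V
  have hnorm : ∀ x, p ∣ orderOf x → ‖LinearMap.trace ℂ V (ρ x)‖ = 1 := fun x hx => by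
    obtain ⟨n, hn, h⟩ := hroot x hx
    exact Complex.norm_eq_one_of_pow_eq_one h hn.ne'
  have hinj : ∀ g, ρ g = 1 → g = 1 := fun g hg => hfaithful g <| by
    rw [FDRep.character, FDRep.character, map_one]
    exact congrArg _ hg
  have hreg := fun z => not_dvd_orderOf_of_mem_center hs hnonlinear hnorm (z := z)
  have hPZ : P ⊓ Subgroup.center G = ⊥ := by
    rw [eq_bot_iff]
    rintro z ⟨hz, hzc⟩
    by_contra h1
    exact hreg z hzc (hPp.dvd_orderOf_of_mem hp hz h1)
  have hPcomm : IsMulCommutative P := by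
    set A := P ⊓ Subgroup.centralizer (P : Set G) with hA
    have hAP : A ≤ P := inf_le_left
    have hAp : IsPGroup p A := hPp.to_le hAP
    have hAcomm : IsMulCommutative A :=
      ⟨⟨fun a b => Subtype.ext (Subgroup.mem_centralizer_iff.mp b.2.2 a a.2.1)⟩⟩
    have := Fintype.ofFinite A
    have hAne : 1 < Fintype.card A := by
      have := (Subgroup.nontrivial_iff_ne_bot P).mpr hPne
      have := hPp.center_nontrivial
      obtain ⟨x, hx⟩ := exists_ne (1 : Subgroup.center P)
      rw [Fintype.one_lt_card_iff_nontrivial, Subgroup.nontrivial_iff_exists_ne_one]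
      refine ⟨x, ⟨x.1.2, Subgroup.mem_centralizer_iff.mpr fun y hy => ?_⟩, fun h => ?_⟩
      · exact congrArg Subtype.val (Subgroup.mem_center_iff.mp x.2 ⟨y, hy⟩)
      · exact hx (Subtype.ext (Subtype.ext h))
    obtain ⟨hdim, h1, hr⟩ := weightProj_structure hs hnonlinear hAne fun a ha =>
      hnorm a (hAp.dvd_orderOf_of_mem hp a.2 fun h => ha (Subtype.ext h))
    have hC := centralizer_le_sup_center hp hAp hinj hnonlinear hnorm hdim h1 hr
    have hPA : P ≤ A := fun x hx => by
      have hxC : x ∈ Subgroup.centralizer (A : Set G) :=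
        Subgroup.mem_centralizer_iff.mpr fun y hy =>
          (Subgroup.mem_centralizer_iff.mp hy.2 x hx).symm
      obtain ⟨a, ha, z, hz, rfl⟩ := Subgroup.mem_sup_of_normal_right.mp (hC hxC)
      have : z ∈ P ⊓ Subgroup.center G := ⟨(Subgroup.mul_mem_cancel_left P (hAP ha)).mp hx, hz⟩
      rw [hPZ, Subgroup.mem_bot] at this
      rwa [this, mul_one]
    exact ⟨⟨fun a b => Subtype.ext
      (Subgroup.mem_centralizer_iff.mp (hPA b.2).2 a a.2)⟩⟩
  have := Fintype.ofFinite P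
  have hP1 : 1 < Fintype.card P := by
    rw [Fintype.one_lt_card_iff_nontrivial]
    exact (Subgroup.nontrivial_iff_ne_bot P).mpr hPne
  obtain ⟨hdim, h1, hr⟩ := weightProj_structure hs hnonlinear hP1 fun a ha =>
    hnorm a (hPp.dvd_orderOf_of_mem hp a.2 fun h => ha (Subtype.ext h))
  have hC : Subgroup.centralizer (P : Set G) = P ⊔ Subgroup.center G :=
    le_antisymm (centralizer_le_sup_center hp hPp hinj hnonlinear hnorm hdim h1 hr)
      (sup_le (Subgroup.le_centralizer P) (Subgroup.center_le_centralizer _))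
  have htrans : ∀ χ ψ : P →* ℂˣ, χ ≠ 1 → ψ ≠ 1 → ∃ g : G, conjChar g χ = ψ :=
    fun χ ψ hχ hψ => exists_conjChar_eq_of_finrank_range hs (hr χ hχ) (hr ψ hψ)
  obtain ⟨hpow, hexp⟩ := pow_eq_one_of_conjChar_transitive hp hPp hP1 htrans
  by_cases hidx : p ∣ P.index
  · right
    obtain ⟨q, hq⟩ := exists_prime_orderOf_dvd_card' p (G := G ⧸ P) hidx
    obtain ⟨g, rfl⟩ := QuotientGroup.mk_surjective q
    have hgp : g ^ p ∈ P := by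
      rw [← QuotientGroup.eq_one_iff, QuotientGroup.mk_pow, ← hq, pow_orderOf_eq_one]
    have hsing : ∀ x : P, p ∣ orderOf (g * x) := fun x => by
      have h := orderOf_map_dvd (QuotientGroup.mk' P) (g * x)
      rw [QuotientGroup.mk'_apply, QuotientGroup.mk_mul, (QuotientGroup.eq_one_iff _).mpr x.2,
        mul_one, hq] at h
      exact h
    have hfix := sum_norm_sq_trace_mul h1 hr g
    rw [Finset.sum_congr rfl fun x _ => by rw [hnorm _ (hsing x), one_pow], Finset.sum_const,
      Finset.card_univ, nsmul_one, eq_comm,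
      mul_eq_left₀ (by exact_mod_cast (zero_lt_one.trans hP1).ne'), Nat.cast_eq_one] at hfix
    obtain ⟨rfl, h4⟩ := card_eq_four_of_unique_fixed hp hPp (by omega) hpow hgp hfix
    have hZ : Odd (Nat.card (Subgroup.center G)) := by
      rw [← Nat.not_even_iff_odd, even_iff_two_dvd]
      intro h2
      obtain ⟨z, hz⟩ := exists_prime_orderOf_dvd_card' 2 h2
      exact hreg z z.2 (by rw [Subgroup.orderOf_coe, hz])
    have h3 := card_sub_one_dvd_index_centralizer hP1 htrans
    rw [h4] at h3
    exact ⟨rfl, hZ, nonempty_mulEquiv_perm_four_prod_center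
      (by rw [Nat.card_eq_fintype_card, h4]) hC hPZ hZ hidx h3⟩
  · left
    refine ⟨⟨fun a b => hPcomm.is_comm.comm a b, hexp⟩, hidx, hC, hPZ, fun lam mu hl hm => ?_, by
      rw [Nat.card_eq_fintype_card, hdim]⟩
    have hunits : ∀ f : P →* ℂ, f ≠ 1 → f.toHomUnits ≠ 1 := fun f hf h =>
      hf (MonoidHom.ext fun x => congrArg Units.val (DFunLike.congr_fun h x))
    obtain ⟨g, hg⟩ := htrans _ _ (hunits lam hl) (hunits mu hm)
    refine ⟨g, fun x hx hx' => ?_⟩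
    have h := congrArg Units.val (DFunLike.congr_fun hg ⟨x, hx⟩)
    rw [conjChar_apply, MonoidHom.coe_toHomUnits, MonoidHom.coe_toHomUnits] at h
    rw [← h]
    congr 1
    ext
    rw [MulAut.conjNormal_apply, inv_inv]
end

section
/- Let G be a finite group and let τ be a complex character of G whose determinantal character det τ has odd order (as an element of the group of linear characters of G). Then for every involution x ∈ G, the value τ(x) is an integer and τ(x) ≡ τ(1) (mod 4). -/
open CategoryTheory Module

theorem Multiset.exists_int_sum_eq_and_modEq_card_of_sq_eq_one (s : Multiset ℂ)
    (hs : ∀ r ∈ s, r ^ 2 = 1) :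
    ∃ k : ℤ, s.sum = k ∧
      (s.prod = 1 ∧ k ≡ s.card [ZMOD 4] ∨ s.prod = -1 ∧ k ≡ s.card + 2 [ZMOD 4]) := by
  induction s using Multiset.induction_on with
  | empty => exact ⟨0, by simp⟩
  | cons a s ih =>
    obtain ⟨k, hk, h⟩ := ih fun r hr => hs r (Multiset.mem_cons_of_mem hr)
    simp only [Multiset.sum_cons, Multiset.prod_cons, Multiset.card_cons, Int.ModEq] at *
    rcases eq_or_eq_neg_of_sq_eq_sq a 1 (by rw [hs a (Multiset.mem_cons_self a s), one_pow]) with rfl | rfl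
    · refine ⟨1 + k, by simp [hk], h.imp ?_ ?_⟩ <;> rintro ⟨hp, hc⟩ <;>
        refine ⟨by simp [hp], ?_⟩ <;> push_cast <;> omega
    · refine ⟨-1 + k, by simp [hk], h.symm.imp ?_ ?_⟩ <;> rintro ⟨hp, hc⟩ <;>
        refine ⟨by simp [hp], ?_⟩ <;> push_cast <;> omega

theorem LinearMap.exists_int_trace_eq_and_modEq_finrank {V : Type*} [AddCommGroup V] [Module ℂ V]
    [FiniteDimensional ℂ V] (f : V →ₗ[ℂ] V) (hf : f ^ 2 = 1) (hdet : LinearMap.det f = 1) :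
    ∃ k : ℤ, LinearMap.trace ℂ V f = k ∧ k ≡ (finrank ℂ V : ℤ) [ZMOD 4] := by
  have hroots : ∀ r ∈ f.charpoly.roots, r ^ 2 = 1 := by
    intro r hr
    have he : Module.End.HasEigenvalue f r :=
      Module.End.hasEigenvalue_iff_isRoot_charpoly f r |>.mpr (Polynomial.isRoot_of_mem_roots hr)
    obtain ⟨v, hv⟩ := he.exists_hasEigenvector
    have h := hv.pow_apply 2
    rw [hf, Module.End.one_apply] at h
    have h' : (r ^ 2 - 1) • v = 0 := by rw [sub_smul, ← h, one_smul, sub_self]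
    exact sub_eq_zero.mp ((smul_eq_zero.mp h').resolve_right hv.2)
  have hsplits : f.charpoly.Splits := IsAlgClosed.splits _
  obtain ⟨k, hk, h⟩ := f.charpoly.roots.exists_int_sum_eq_and_modEq_card_of_sq_eq_one hroots
  have hcard : f.charpoly.roots.card = finrank ℂ V := by
    rw [← hsplits.natDegree_eq_card_roots, LinearMap.charpoly_natDegree]
  refine ⟨k, (Module.End.trace_eq_sum_roots_charpoly_of_splits hsplits).trans hk, ?_⟩
  rcases h with ⟨-, h⟩ | ⟨h, -⟩
  · rwa [hcard] at h
  · rw [← Module.End.det_eq_prod_roots_charpoly_of_splits hsplits, hdet] at h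
    norm_num at h

theorem MonoidHom.map_eq_one_of_odd_orderOf {G M : Type*} [Monoid G] [CommMonoid M]
    (χ : G →* M) (hχ : Odd (orderOf χ)) {x : G} (hx : x ^ 2 = 1) : χ x = 1 := by
  have h₁ : χ x ^ orderOf χ = 1 := by
    rw [← MonoidHom.pow_apply, pow_orderOf_eq_one, MonoidHom.one_apply]
  have h₂ : χ x ^ 2 = 1 := by rw [← map_pow, hx, map_one]
  obtain ⟨m, hm⟩ := hχ
  rwa [hm, pow_succ, pow_mul, h₂, one_pow, one_mul] at h₁

/-- Step in the proof of **Theorem 2.5** (Navarro–Robinson). Let `τ` be a complex character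
of a finite group `G`, afforded by a representation `V`, whose determinantal character
`det τ : g ↦ det(ρ(g))` has odd order in the group of linear characters of `G`. Then for
every involution `x ∈ G`, the value `τ(x)` is an integer congruent to `τ(1)` modulo `4`. -/
theorem stmt_15 {G : Type} [Group G] [Fintype G] (V : FDRep ℂ G)
    (hdet : Odd (orderOf ((LinearMap.det : (V →ₗ[ℂ] V) →* ℂ).comp V.ρ)))
    (x : G) (hx : orderOf x = 2) :
    ∃ k : ℤ, V.character x = (k : ℂ) ∧ k ≡ (finrank ℂ V : ℤ) [ZMOD 4] := by
  have hx2 : x ^ 2 = 1 := hx ▸ pow_orderOf_eq_one x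
  exact LinearMap.exists_int_trace_eq_and_modEq_finrank (V.ρ x)
    (by rw [← map_pow, hx2, map_one]) (MonoidHom.map_eq_one_of_odd_orderOf _ hdet hx2)
end
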